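/- arXiv:1811.04918 — 2 statements merged into one kernel-verified Lean document; each statement's English description precedes it below -/
import Mathlib

section
/- Information out of randomness. Let φ(z) = Σ_{i≥0} c_i z^i be a power series with C := 𝔠_ε(φ,1) < ∞ and let w* ∈ ℝ^d with ‖w*‖₂ = 1. Let v₁^{(0)} ∈ ℝ^{m₁} have i.i.d. N(0,1/m₂) entries and let W^{(0)} ∈ ℝ^{m₁×d} and b₁^{(0)} ∈ ℝ^{m₁} have i.i.d. N(0,1/m₁) entries, all independent, and let n₁(x) = Σ_{r∈[m₁]} v^{(0)}_{1,r}·σ(⟨w_r^{(0)},x⟩ + b^{(0)}_{1,r}) with σ(z) = max(z,0). Then for every ε ∈ (0, 1/𝔠_s(φ,1)) there exist deterministic real-valued functions ρ(v₁^{(0)}, W^{(0)}, b₁^{(0)}), B(x, v₁^{(0)}, W^{(0)}, b₁^{(0)}), R(x, v₁^{(0)}, W^{(0)}, b₁^{(0)}) and φ_ε(x) such that: (i) for every x, n₁(x) = ρ·φ_ε(x) + B(x,·) + R(x,·); (ii) for every fixed x, the random variable ρ is independent of B(x,·); (iii) ρ ∼ N(0, 1/(100·C²·m₂)); (iv) for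 every x with ‖x‖₂ = 1 and x_d = 1/2, |φ_ε(x) − φ(⟨w*,x⟩)| ≤ ε; (v) for every fixed x with ‖x‖₂ = 1 and x_d = 1/2, with high probability |R(x,·)| ≤ Õ(1/√(m₁m₂)) and |B(x,·)| ≤ Õ(1/√m₂). -/
open MeasureTheory ProbabilityTheory
open scoped BigOperators

/-- The sufficiently large absolute constant `C*` (taken to be `10⁴`). -/
noncomputable def Cstar : ℝ := 10 ^ 4

/-- The value `φ(z) = ∑ᵢ cᵢ zⁱ` of the power series with coefficients `c`. -/
noncomputable def psVal (c : ℕ → ℝ) (z : ℝ) : ℝ := ∑' i, c i * z ^ i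

/-- The summand of the sample-complexity measure `𝔠_s(φ,R)`. -/
noncomputable def csSummand (c : ℕ → ℝ) (R : ℝ) (i : ℕ) : ℝ :=
  ((i : ℝ) + 1) ^ (1.75 : ℝ) * R ^ i * |c i|

/-- Sample complexity `𝔠_s(φ,R) = C* ∑ᵢ (i+1)^{1.75} Rⁱ |cᵢ|`. -/
noncomputable def csOf (c : ℕ → ℝ) (R : ℝ) : ℝ := Cstar * ∑' i, csSummand c R i

/-- The summand of the size-complexity measure `𝔠_ε(φ,R)`. -/
noncomputable def ceSummand (c : ℕ → ℝ) (R ε : ℝ) (i : ℕ) : ℝ :=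
  ((Cstar * R) ^ i
      + (Real.sqrt (Real.log (1 / ε)) / Real.sqrt i * (Cstar * R)) ^ i) * |c i|

/-- Size complexity `𝔠_ε(φ,R) = ∑ᵢ ((C*R)ⁱ + (√(log(1/ε))/√i · C*R)ⁱ) |cᵢ|`. -/
noncomputable def ceOf (c : ℕ → ℝ) (R ε : ℝ) : ℝ := ∑' i, ceSummand c R ε i

/-- The distribution of `(v₁⁽⁰⁾, W⁽⁰⁾, b₁⁽⁰⁾)`: entries of `v₁⁽⁰⁾` i.i.d. `N(0,1/m₂)` and
entries of `W⁽⁰⁾, b₁⁽⁰⁾` i.i.d. `N(0,1/m₁)`. -/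
noncomputable def initRand (d m₁ m₂ : ℕ) :
    Measure ((Fin m₁ → ℝ) × (Fin m₁ → Fin d → ℝ) × (Fin m₁ → ℝ)) :=
  (Measure.pi fun _ : Fin m₁ => gaussianReal 0 (Real.toNNReal (1 / (m₂ : ℝ)))).prod
    ((Measure.pi fun _ : Fin m₁ => Measure.pi fun _ : Fin d =>
        gaussianReal 0 (Real.toNNReal (1 / (m₁ : ℝ)))).prod
      (Measure.pi fun _ : Fin m₁ => gaussianReal 0 (Real.toNNReal (1 / (m₁ : ℝ)))))

/-- The input to one neuron of the second layer at random initialization: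
`n₁(x) = ∑_r v⁽⁰⁾_{1,r} σ(⟨w_r⁽⁰⁾,x⟩ + b⁽⁰⁾_{1,r})`. -/
noncomputable def neuronInput {d m₁ : ℕ} (v : Fin m₁ → ℝ) (W : Fin m₁ → Fin d → ℝ)
    (b : Fin m₁ → ℝ) (x : Fin d → ℝ) : ℝ :=
  ∑ r, v r * max ((∑ l, W r l * x l) + b r) 0


open Polynomial in
/-- Monic probabilist Hermite polynomials over the reals, by recursion. -/
noncomputable def HeP : ℕ → Polynomial ℝ
  | 0 => 1
  | 1 => X
  | (n+2) => X * HeP (n+1) - C ((n:ℝ)+1) * HeP n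

noncomputable def He (n : ℕ) (x : ℝ) : ℝ := (HeP n).eval x

noncomputable abbrev gam : Measure ℝ := gaussianReal 0 1

lemma He_zero (x : ℝ) : He 0 x = 1 := by simp [He, HeP]
lemma He_one (x : ℝ) : He 1 x = x := by simp [He, HeP]
lemma He_succ_succ (n : ℕ) (x : ℝ) : He (n+2) x = x * He (n+1) x - ((n:ℝ)+1) * He n x := by
  simp [He, HeP]

open Polynomial in
lemma HeP_deriv (n : ℕ) : derivative (HeP (n+1)) = C ((n:ℝ)+1) * HeP n := by
  induction n using Nat.strong_induction_on with
  | _ n ih =>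
    match n with
    | 0 => simp [HeP]
    | 1 => 
      simp only [HeP]; simp
      ring_nf
    | (k+2) =>
      have h1 := ih (k+1) (by omega)
      have h0 := ih k (by omega)
      have e : HeP (k+3) = X * HeP (k+2) - C (((k+1:ℕ):ℝ)+1) * HeP (k+1) := by rw [HeP]
      have e2 : HeP (k+2) = X * HeP (k+1) - C ((k:ℝ)+1) * HeP k := by rw [HeP]
      rw [e]
      simp only [derivative_sub, derivative_mul, derivative_X, derivative_C, h1, h0]
      rw [e2]
      simp only [C_add, Nat.cast_add, Nat.cast_ofNat, Nat.cast_one, C_1]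
      have h2 : (C (2:ℝ) : Polynomial ℝ) = 2 := rfl
      rw [h2]
      ring

lemma He_cont (n : ℕ) : Continuous (He n) := (HeP n).continuous

lemma He_upper (B : ℝ) (n : ℕ) (hB : (n:ℝ) ≤ B^2) (hB0 : 0 ≤ B) (x : ℝ) (hx : |x| ≤ B) :
    |He n x| ≤ (2*B)^n := by
  have key : ∀ k, k ≤ n → |He k x| ≤ (2*B)^k := by
    intro k
    induction k using Nat.strong_induction_on with
    | _ k ih =>
      match k with
      | 0 => intro _; simp [He_zero]
      | 1 => intro _; simp [He_one]; linarith
      | (j+2) =>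
        intro hj
        have h1 := ih (j+1) (by omega) (by omega)
        have h0 := ih j (by omega) (by omega)
        rw [He_succ_succ]
        have hjn : ((j:ℝ)+1) ≤ B^2 := by
          have : ((j+2:ℕ):ℝ) ≤ n := by exact_mod_cast hj
          push_cast at this; linarith
        calc |x * He (j+1) x - ((j:ℝ)+1) * He j x| 
            ≤ |x * He (j+1) x| + |((j:ℝ)+1) * He j x| := abs_sub _ _
          _ = |x| * |He (j+1) x| + ((j:ℝ)+1) * |He j x| := by
              rw [abs_mul, abs_mul, abs_of_nonneg (by positivity : (0:ℝ) ≤ (j:ℝ)+1)]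
          _ ≤ B * (2*B)^(j+1) + B^2 * (2*B)^j := by gcongr
          _ ≤ (2*B)^(j+2) := by
              have : 0 ≤ (2*B)^j * B^2 := by positivity
              rw [pow_add, pow_add]; nlinarith
  exact key n le_rfl

lemma He_lower (n : ℕ) (x : ℝ) (hx0 : 0 < x) (hx : 4 * (n:ℝ) ≤ x^2) :
    2 * (x/2)^(n+1) ≤ He (n+1) x := by
  have key : ∀ k, k ≤ n → 0 < He k x ∧ (x/2) * He k x ≤ He (k+1) x := by
    intro k
    induction k with
    | zero => intro _; simp [He_zero, He_one]; linarith
    | succ j ih =>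
      intro hj
      obtain ⟨h0, h1⟩ := ih (by omega)
      have hp : 0 < He (j+1) x := lt_of_lt_of_le (by positivity) h1
      refine ⟨hp, ?_⟩
      rw [He_succ_succ]
      have hjn : ((j:ℝ)+1) ≤ n := by exact_mod_cast hj
      have : ((j:ℝ)+1) * He j x ≤ x/2 * He (j+1) x := by
        have a1 : x * (((j:ℝ)+1) * He j x) ≤ x * (x/2 * He (j+1) x) := by
          calc x * (((j:ℝ)+1) * He j x) = 2 * ((j:ℝ)+1) * (x/2 * He j x) := by ring
            _ ≤ 2 * ((j:ℝ)+1) * He (j+1) x := by gcongr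
            _ ≤ x * (x/2 * He (j+1) x) := by nlinarith
        exact le_of_mul_le_mul_left a1 hx0
      linarith
  have key2 : ∀ k, k ≤ n → 2 * (x/2)^(k+1) ≤ He (k+1) x := by
    intro k
    induction k with
    | zero => intro _; simp [He_one]; linarith
    | succ j ih =>
      intro hj
      have := (key (j+1) hj).2
      have h2 := ih (by omega)
      calc 2 * (x/2)^(j+1+1) = x/2 * (2 * (x/2)^(j+1)) := by ring
        _ ≤ x/2 * He (j+1) x := by gcongr
        _ ≤ _ := this
  exact key2 n le_rfl

lemma poly_integrable (p : Polynomial ℝ) : Integrable (fun x => p.eval x) gam := by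
  induction p using Polynomial.induction_on' with
  | add p q hp hq =>
    have e : (fun x => (p+q).eval x) = (fun x => p.eval x) + fun x => q.eval x := by
      ext x; simp
    rw [e]; exact hp.add hq
  | monomial n a =>
    simp only [Polynomial.eval_monomial]
    apply Integrable.const_mul
    have := (memLp_id_gaussianReal (μ := 0) (v := 1) (n : NNReal))
    by_cases hn : n = 0
    · subst hn; simp
    have h := this.integrable_norm_pow (p := n) hn
    refine (integrable_norm_iff (by fun_prop)).1 ?_
    simpa using h

open Polynomial in
lemma stein (p : Polynomial ℝ) :
    ∫ x, x * p.eval x ∂gam = ∫ x, (derivative p).eval x ∂gam := by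
  have hv : (1:NNReal) ≠ 0 := one_ne_zero
  have hi : ∀ q : Polynomial ℝ, Integrable (fun x => gaussianPDFReal 0 1 x * q.eval x) := by
    intro q
    have := poly_integrable q
    rw [gam, gaussianReal_of_var_ne_zero _ hv] at this
    rw [integrable_withDensity_iff_integrable_smul₀' (by fun_prop) (by simp [gaussianPDF])] at this
    simpa [gaussianPDF, ENNReal.toReal_ofReal, gaussianPDFReal_nonneg] using this
  have hd : ∀ x, HasDerivAt (fun x => gaussianPDFReal 0 1 x * p.eval x)
      (gaussianPDFReal 0 1 x * (derivative p - X * p).eval x) x := by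
    intro x
    have h1 : HasDerivAt (gaussianPDFReal 0 1) (gaussianPDFReal 0 1 x * (-x)) x := by
      rw [gaussianPDFReal_def]
      have : HasDerivAt (fun x:ℝ => -(x-0)^2/(2*((1:NNReal):ℝ))) (-x) x := by
        have := (((hasDerivAt_id x).sub_const 0).pow 2).neg.div_const (2*((1:NNReal):ℝ))
        refine HasDerivAt.congr_deriv this ?_
        simp
        ring
      refine HasDerivAt.congr_deriv ((this.exp).const_mul ((√(2 * Real.pi * ((1:NNReal):ℝ)))⁻¹)) ?_
      ring
    refine HasDerivAt.congr_deriv (h1.mul (p.hasDerivAt x)) ?_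
    simp; ring
  have := integral_eq_zero_of_hasDerivAt_of_integrable hd (hi _) (hi _)
  have e : ∀ q : Polynomial ℝ, ∫ x, q.eval x ∂gam = ∫ x, gaussianPDFReal 0 1 x * q.eval x := by
    intro q
    rw [gam, integral_gaussianReal_eq_integral_smul hv]; rfl
  rw [← e] at this
  simp only [eval_sub, eval_mul, eval_X] at this
  rw [integral_sub (poly_integrable _)] at this
  · linarith
  · have h := poly_integrable (X * p)
    have e' : (fun x => (X * p).eval x) = fun x => x * p.eval x := by ext x; simp
    rwa [e'] at h

open Polynomial in
lemma He_avg (t s : ℝ) (hts : t^2 + s^2 = 1) (y : ℝ) (n : ℕ) :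
    ∫ z, He n (t*y + s*z) ∂gam = t^n * He n y := by
  set P : ℕ → Polynomial ℝ := fun k => (HeP k).comp (C (t*y) + C s * X) with hP
  have hPe : ∀ k z, (P k).eval z = He k (t*y+s*z) := by
    intro k z; simp [hP, He]
  induction n using Nat.strong_induction_on with
  | _ n ih =>
    match n with
    | 0 => simp [He_zero]
    | 1 => 
      simp only [He_one]
      have hid : Integrable (fun x:ℝ => x) gam := by simpa using poly_integrable X
      have hz : ∫ z, z ∂gam = 0 := integral_id_gaussianReal
      rw [integral_add (integrable_const _) (hid.const_mul s), integral_const_mul s, hz]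
      simp
    | (k+2) =>
      have h1 := ih (k+1) (by omega)
      have h0 := ih k (by omega)
      have hd : derivative (P (k+1)) = C (s * ((k:ℝ)+1)) * P k := by
        simp only [hP, derivative_comp, HeP_deriv]
        simp
        ring
      have st := stein (P (k+1))
      rw [hd] at st
      simp only [eval_mul, eval_C, hPe, integral_const_mul] at st
      simp only [He_succ_succ]
      have i1 : Integrable (fun z => He (k+1) (t*y+s*z)) gam := by
        simpa only [hPe] using poly_integrable (P (k+1))
      have i0 : Integrable (fun z => He k (t*y+s*z)) gam := by
        simpa only [hPe] using poly_integrable (P k)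
      have i2 : Integrable (fun z => z * He (k+1) (t*y+s*z)) gam := by
        have h := poly_integrable (X * P (k+1))
        have e' : (fun x => (X * P (k+1)).eval x) = fun z => z * He (k+1) (t*y+s*z) := by
          ext x; simp [hPe]
        rwa [e'] at h
      have : ∀ z, (t*y+s*z) * He (k+1) (t*y+s*z) - ((k:ℝ)+1) * He k (t*y+s*z)
        = (t*y) * He (k+1) (t*y+s*z) + s * (z * He (k+1) (t*y+s*z)) - ((k:ℝ)+1) * He k (t*y+s*z) := by
        intro z; ring
      simp only [this]
      have i3 : Integrable (fun z => (t*y) * He (k+1) (t*y+s*z) + s * (z * He (k+1) (t*y+s*z))) gam :=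
        (i1.const_mul _).add (i2.const_mul _)
      rw [integral_sub i3 (i0.const_mul _),
        integral_add (i1.const_mul _) (i2.const_mul _), integral_const_mul, integral_const_mul,
        integral_const_mul, st, h1, h0]
      have : s^2 = 1 - t^2 := by linarith
      ring_nf
      rw [this]; ring

lemma gam_exp_sq : Integrable (fun x:ℝ => Real.exp (7/16 * x^2)) gam ∧
    ∫ x, Real.exp (7/16 * x^2) ∂gam ≤ 3 := by
  have hv : (1:NNReal) ≠ 0 := one_ne_zero
  have e : ∀ x:ℝ, gaussianPDFReal 0 1 x * Real.exp (7/16*x^2) =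
      (√(2*Real.pi))⁻¹ * Real.exp (-(1/16) * x^2) := by
    intro x
    simp only [gaussianPDFReal_def, NNReal.coe_one, mul_one, sub_zero, mul_assoc, ← Real.exp_add]
    congr 2; ring
  constructor
  · rw [gam, gaussianReal_of_var_ne_zero _ hv]
    rw [integrable_withDensity_iff_integrable_smul₀' (by fun_prop) (by simp [gaussianPDF])]
    simp only [toReal_gaussianPDF, smul_eq_mul]
    simp_rw [e]
    exact (integrable_exp_neg_mul_sq (by norm_num)).const_mul _
  · rw [gam, integral_gaussianReal_eq_integral_smul hv]
    simp only [smul_eq_mul]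
    simp_rw [e]
    rw [integral_const_mul, integral_gaussian]
    have hpi := Real.pi_pos
    have : √(Real.pi / (1/16)) = √8 * √(2*Real.pi) := by
      rw [← Real.sqrt_mul (by norm_num)]; congr 1; ring
    rw [this]
    have h2 : √(2*Real.pi) ≠ 0 := by positivity
    field_simp
    rw [Real.sqrt_le_left (by norm_num)]; norm_num

lemma gam_Icc (a c : ℝ) (hac : a ≤ c) (m : ℝ) (h1 : |a| ≤ m) (h2 : |c| ≤ m) :
    (c - a) * ((√(2*Real.pi))⁻¹ * Real.exp (-(m^2)/2)) ≤ gam.real (Set.Icc a c) := by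
  have hv : (1:NNReal) ≠ 0 := one_ne_zero
  rw [measureReal_def, gam, gaussianReal_apply_eq_integral _ hv, ENNReal.toReal_ofReal
    (integral_nonneg fun x => gaussianPDFReal_nonneg _ _ _)]
  have : (c - a) * ((√(2*Real.pi))⁻¹ * Real.exp (-(m^2)/2)) =
    ∫ x in Set.Icc a c, ((√(2*Real.pi))⁻¹ * Real.exp (-(m^2)/2)) := by
    rw [setIntegral_const]; simp [measureReal_def, hac]
  rw [this]
  apply setIntegral_mono_on
  · exact integrableOn_const (by simp)
  · exact (integrable_gaussianPDFReal 0 1).integrableOn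
  · exact measurableSet_Icc
  · intro x hx
    simp only [gaussianPDFReal_def, NNReal.coe_one, mul_one, sub_zero]
    have : x^2 ≤ m^2 := by
      rw [abs_le] at h1 h2
      apply sq_le_sq'
      · linarith [hx.1]
      · linarith [hx.2]
    gcongr

lemma int_id : Integrable (fun x:ℝ => x) gam := by
  have := poly_integrable Polynomial.X
  simpa using this

lemma int_abs_le : ∫ x, |x| ∂gam ≤ 1 := by
  have h2 : ∫ x, x * Polynomial.X.eval x ∂gam = 1 := by
    rw [stein]; simp
  simp only [Polynomial.eval_X] at h2
  have i2 : Integrable (fun x:ℝ => x*x) gam := by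
    have := poly_integrable (Polynomial.X * Polynomial.X)
    refine this.congr (ae_of_all _ fun x => ?_)
    simp
  have : ∫ x, |x| ∂gam ≤ ∫ x, (1 + x*x)/2 ∂gam := by
    apply integral_mono int_id.abs
    · exact ((integrable_const _).add i2).div_const 2
    · intro x
      have := sq_nonneg (|x| - 1)
      have h3 := abs_mul_abs_self x
      simp only
      nlinarith
  rw [integral_div, integral_add (integrable_const _) i2, h2] at this
  simp at this; linarith

lemma ext2 (μ ν : Measure (ℝ×ℝ)) [IsFiniteMeasure μ] [IsFiniteMeasure ν]
    (h : ∀ a c : ℝ, ∫ p, Complex.exp (((a*p.1+c*p.2 : ℝ):ℂ) * Complex.I) ∂μ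
      = ∫ p, Complex.exp (((a*p.1+c*p.2 : ℝ):ℂ) * Complex.I) ∂ν) : μ = ν := by
  apply Measure.ext_of_charFunDual
  ext L
  have hL : ∀ p : ℝ×ℝ, L p = L (1,0) * p.1 + L (0,1) * p.2 := by
    intro p
    have : p = p.1 • ((1:ℝ),(0:ℝ)) + p.2 • ((0:ℝ),(1:ℝ)) := by ext <;> simp
    conv_lhs => rw [this]
    rw [map_add, map_smul, map_smul]; simp; ring
  have e : (fun p : ℝ×ℝ => Complex.exp ((L p : ℂ) * Complex.I)) =
      fun p => Complex.exp (((L (1,0)*p.1+L (0,1)*p.2 : ℝ):ℂ) * Complex.I) := by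
    ext p; rw [hL p]
  rw [charFunDual_apply, charFunDual_apply, e]
  exact h _ _

lemma cf_gauss (v : NNReal) (k : ℝ) :
    ∫ x, Complex.exp (((k*x:ℝ):ℂ) * Complex.I) ∂(gaussianReal 0 v) = Complex.exp (((-(v*k^2/2) :ℝ):ℂ)) := by
  have := charFun_gaussianReal (μ := 0) (v := v) k
  rw [charFun_apply_real] at this
  push_cast at this ⊢
  rw [this]; congr 1; simp

lemma cf_pi {ι : Type*} [Fintype ι] (v : NNReal) (k : ι → ℝ) :
    ∫ w : ι → ℝ, Complex.exp (((∑ l, k l * w l:ℝ):ℂ) * Complex.I) ∂(Measure.pi fun _ => gaussianReal 0 v)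
      = Complex.exp (((-(v*(∑ l, k l^2)/2) :ℝ):ℂ)) := by
  have e : ∀ w : ι → ℝ, Complex.exp (((∑ l, k l * w l:ℝ):ℂ) * Complex.I)
      = ∏ l, Complex.exp (((k l * w l:ℝ):ℂ) * Complex.I) := by
    intro w; rw [← Complex.exp_sum]; congr 1; push_cast; rw [Finset.sum_mul]
  simp_rw [e]
  rw [integral_fintype_prod_eq_prod (f := fun l (x:ℝ) => Complex.exp (((k l * x:ℝ):ℂ) * Complex.I))]
  simp_rw [cf_gauss]
  rw [← Complex.exp_sum]; congr 1
  rw [← Complex.ofReal_sum]; congr 1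
  rw [Finset.mul_sum, Finset.sum_div, Finset.sum_neg_distrib]

lemma cf_prod (k₁ k₂ : ℝ) :
    ∫ p : ℝ×ℝ, Complex.exp (((k₁*p.1+k₂*p.2:ℝ):ℂ) * Complex.I) ∂(gam.prod gam)
      = Complex.exp (((-((k₁^2+k₂^2)/2) :ℝ):ℂ)) := by
  have e : ∀ p : ℝ×ℝ, Complex.exp (((k₁*p.1+k₂*p.2:ℝ):ℂ) * Complex.I)
      = Complex.exp (((k₁*p.1:ℝ):ℂ) * Complex.I) * Complex.exp (((k₂*p.2:ℝ):ℂ) * Complex.I) := by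
    intro p; rw [← Complex.exp_add]; congr 1; push_cast; ring
  simp_rw [e]
  rw [integral_prod_mul (fun x:ℝ => Complex.exp (((k₁*x:ℝ):ℂ) * Complex.I))
    (fun x:ℝ => Complex.exp (((k₂*x:ℝ):ℂ) * Complex.I)), cf_gauss, cf_gauss, ← Complex.exp_add]
  congr 1; push_cast; ring

/-- joint law of two standard Gaussians with correlation `t`. -/
noncomputable def lawt (t : ℝ) : Measure (ℝ×ℝ) :=
  (gam.prod gam).map (fun p => (p.1, t*p.1+√(1-t^2)*p.2))

instance (t : ℝ) : IsProbabilityMeasure (lawt t) :=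
  Measure.isProbabilityMeasure_map (by fun_prop)

lemma lawt_cf (t : ℝ) (ht : |t| ≤ 1) (a c : ℝ) :
    ∫ p, Complex.exp (((a*p.1+c*p.2 : ℝ):ℂ) * Complex.I) ∂(lawt t)
      = Complex.exp (((-((a^2+2*a*c*t+c^2)/2) :ℝ):ℂ)) := by
  rw [lawt, integral_map (by fun_prop) (by fun_prop)]
  have e : ∀ p : ℝ×ℝ, a*p.1+c*(t*p.1+√(1-t^2)*p.2) = (a+c*t)*p.1 + (c*√(1-t^2))*p.2 := by
    intro p; ring
  simp only [e]
  rw [cf_prod]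
  have : √(1-t^2)^2 = 1-t^2 := Real.sq_sqrt (by nlinarith [abs_le.1 ht])
  congr 3
  rw [mul_pow, this]; ring

lemma lawt_rot (t : ℝ) (ht : |t| ≤ 1) :
    lawt t = (gam.prod gam).map (fun p => (t*p.1+√(1-t^2)*p.2, p.1)) := by
  have : IsProbabilityMeasure ((gam.prod gam).map (fun p : ℝ×ℝ => (t*p.1+√(1-t^2)*p.2, p.1))) :=
    Measure.isProbabilityMeasure_map (by fun_prop)
  apply ext2
  intro a c
  rw [lawt_cf t ht, integral_map (by fun_prop) (by fun_prop)]
  have e : ∀ p : ℝ×ℝ, a*(t*p.1+√(1-t^2)*p.2)+c*p.1 = (a*t+c)*p.1 + (a*√(1-t^2))*p.2 := by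
    intro p; ring
  simp only [e]
  rw [cf_prod]
  have : √(1-t^2)^2 = 1-t^2 := Real.sq_sqrt (by nlinarith [abs_le.1 ht])
  congr 3
  rw [mul_pow, this]; ring

lemma lawt_pi {d : ℕ} (v : NNReal) (κ : ℝ) (hκ : v * κ^2 = 1) (p q : Fin d → ℝ)
    (hp : ∑ l, p l^2 = 1) (hq : ∑ l, q l^2 = 1) :
    |∑ l, p l * q l| ≤ 1 ∧
    (Measure.pi fun _ : Fin d => gaussianReal 0 v).map
      (fun w => (κ * ∑ l, w l * p l, κ * ∑ l, w l * q l)) = lawt (∑ l, p l * q l) := by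
  have ht : |∑ l, p l * q l| ≤ 1 := by
    have := Finset.sum_mul_sq_le_sq_mul_sq Finset.univ p q
    rw [hp, hq] at this
    rw [← sq_le_one_iff_abs_le_one]; linarith
  refine ⟨ht, ?_⟩
  have hm : Measurable (fun w : Fin d → ℝ => (κ * ∑ l, w l * p l, κ * ∑ l, w l * q l)) := by fun_prop
  have : IsProbabilityMeasure ((Measure.pi fun _ : Fin d => gaussianReal 0 v).map
      (fun w => (κ * ∑ l, w l * p l, κ * ∑ l, w l * q l))) :=
    Measure.isProbabilityMeasure_map hm.aemeasurable
  apply ext2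
  intro a c
  rw [lawt_cf _ ht, integral_map hm.aemeasurable (by fun_prop)]
  have e : ∀ w : Fin d → ℝ, a*(κ * ∑ l, w l * p l)+c*(κ * ∑ l, w l * q l)
      = ∑ l, (κ*(a*p l + c * q l)) * w l := by
    intro w; simp only [Finset.mul_sum, ← Finset.sum_add_distrib]
    refine Finset.sum_congr rfl fun l _ => ?_; ring
  simp only [e]
  rw [cf_pi]
  congr 3
  have : ∑ l, (κ*(a*p l + c * q l))^2 = κ^2*(a^2 * ∑ l, p l^2 + 2*a*c*∑ l, p l * q l + c^2 * ∑ l, q l^2) := by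
    simp only [Finset.mul_sum, ← Finset.sum_add_distrib]
    refine Finset.sum_congr rfl fun l _ => ?_; ring
  rw [this, hp, hq, ← mul_assoc, hκ]; ring

noncomputable def law3 (t : ℝ) : Measure ((ℝ×ℝ)×ℝ) := (lawt t).prod gam

instance (t : ℝ) : IsProbabilityMeasure (law3 t) := by unfold law3; infer_instance

lemma law3_rep1 (t : ℝ) : law3 t = ((gam.prod gam).prod gam).map
    (fun p => ((p.1.1, t*p.1.1+√(1-t^2)*p.1.2), p.2)) := by
  rw [law3, lawt]
  have := Measure.map_prod_map (gam.prod gam) gam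
    (f := fun p : ℝ×ℝ => (p.1, t*p.1+√(1-t^2)*p.2)) (g := id) (by fun_prop) (by fun_prop)
  rw [Measure.map_id] at this
  rw [this]; rfl

lemma law3_rep2 (t : ℝ) (ht : |t| ≤ 1) : law3 t = ((gam.prod gam).prod gam).map
    (fun p => ((t*p.1.1+√(1-t^2)*p.1.2, p.1.1), p.2)) := by
  rw [law3, lawt_rot t ht]
  have := Measure.map_prod_map (gam.prod gam) gam
    (f := fun p : ℝ×ℝ => (t*p.1+√(1-t^2)*p.2, p.1)) (g := id) (by fun_prop) (by fun_prop)
  rw [Measure.map_id] at this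
  rw [this]; rfl

lemma abs_relu_le (t : ℝ) (ht : |t| ≤ 1) (u v b : ℝ) :
    |max (t*u+√(1-t^2)*v+b) 0| ≤ |u|+|v|+|b| := by
  have h0 : |max (t*u+√(1-t^2)*v+b) 0| ≤ |t*u+√(1-t^2)*v+b| := by
    rw [abs_of_nonneg (le_max_right _ _)]
    exact max_le (le_abs_self _) (abs_nonneg _)
  have hs : √(1-t^2) ≤ 1 := by
    exact Real.sqrt_le_iff.2 ⟨by norm_num, by nlinarith⟩
  calc _ ≤ _ := h0
    _ ≤ |t*u|+|√(1-t^2)*v|+|b| := (abs_add_le _ _).trans (by gcongr; exact abs_add_le _ _)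
    _ ≤ |u|+|v|+|b| := by
      rw [abs_mul, abs_mul, abs_of_nonneg (Real.sqrt_nonneg (1-t^2))]
      have := abs_nonneg u
      have := abs_nonneg v
      gcongr <;> nlinarith [Real.sqrt_nonneg (1-t^2)]

lemma int_Gabs (G : ℝ → ℝ) (h0 : Integrable G gam) (h1 : Integrable (fun u => G u * |u|) gam) :
    Integrable (fun p : (ℝ×ℝ)×ℝ => G p.1.1 * (|p.1.1|+|p.1.2|+|p.2|)) ((gam.prod gam).prod gam) := by
  have ha := int_id.abs
  have c1 : Integrable (fun _ : ℝ => (1:ℝ)) gam := integrable_const _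
  have a1 := (h1.mul_prod c1).mul_prod c1
  have a2 := (h0.mul_prod ha).mul_prod c1
  have a3 := (h0.mul_prod c1).mul_prod ha
  refine ((a1.add a2).add a3).congr (ae_of_all _ fun p => ?_)
  simp only [Pi.add_apply]; ring

lemma He_int (i : ℕ) : Integrable (He i) gam := poly_integrable (HeP i)

lemma He_int_mul (i : ℕ) : Integrable (fun u => |He i u| * |u|) gam := by
  have h := poly_integrable (HeP i * Polynomial.X)
  refine h.abs.congr (ae_of_all _ fun x => ?_)
  simp [He, abs_mul]

lemma int_law3 (t : ℝ) (ht : |t| ≤ 1) (F : ℝ → ℝ) (hF : Measurable F) (q : ℝ → ℝ) (hq : Measurable q)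
    (hq1 : ∀ b, |q b| ≤ 1) (h0 : Integrable F gam) (h1 : Integrable (fun u => |F u| * |u|) gam) :
    Integrable (fun p : (ℝ×ℝ)×ℝ => F p.1.1 * q p.2 * max (p.1.2+p.2) 0) (law3 t) := by
  have hm : Measurable (fun p : (ℝ×ℝ)×ℝ => F p.1.1 * q p.2 * max (p.1.2+p.2) 0) := by fun_prop
  rw [law3_rep1, integrable_map_measure hm.aestronglyMeasurable (by fun_prop)]
  refine (int_Gabs (fun u => |F u|) h0.abs h1).mono' (by
    exact (hm.comp (by fun_prop)).aestronglyMeasurable) (ae_of_all _ fun p => ?_)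
  simp only [Function.comp, norm_mul, Real.norm_eq_abs]
  have := abs_relu_le t ht p.1.1 p.1.2 p.2
  have h2 := hq1 p.2
  calc |F p.1.1| * |q p.2| * _ ≤ |F p.1.1| * 1 * (|p.1.1|+|p.1.2|+|p.2|) := by gcongr
    _ = _ := by ring

lemma tail_law3 (t : ℝ) (ht : |t| ≤ 1) (F : ℝ → ℝ) (hF : Measurable F) (q : ℝ → ℝ) (hq : Measurable q)
    (hq1 : ∀ b, |q b| ≤ 1) (h0 : Integrable F gam) (h1 : Integrable (fun u => |F u| * |u|) gam)
    (hF1 : ∀ u, F u ≠ 0 → 1 ≤ |u|) :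
    |∫ p : (ℝ×ℝ)×ℝ, F p.1.1 * q p.2 * max (p.1.2+p.2) 0 ∂(law3 t)| ≤ 3 * ∫ u, |F u| * |u| ∂gam := by
  have hm : Measurable (fun p : (ℝ×ℝ)×ℝ => F p.1.1 * q p.2 * max (p.1.2+p.2) 0) := by fun_prop
  have hi := int_law3 t ht F hF q hq hq1 h0 h1
  rw [law3_rep1, integrable_map_measure hm.aestronglyMeasurable (by fun_prop)] at hi
  rw [law3_rep1, integral_map (by fun_prop) hm.aestronglyMeasurable]
  refine (abs_integral_le_integral_abs).trans ?_
  have c1 : Integrable (fun _ : ℝ => (1:ℝ)) gam := integrable_const _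
  have ha := int_id.abs
  have b1 := (h1.mul_prod c1).mul_prod c1
  have b2 := (h1.mul_prod ha).mul_prod c1
  have b3 := (h1.mul_prod c1).mul_prod ha
  calc _ ≤ ∫ p : (ℝ×ℝ)×ℝ, (((|F p.1.1| * |p.1.1|) * 1 * 1 + (|F p.1.1| * |p.1.1|) * |p.1.2| * 1) +
        (|F p.1.1| * |p.1.1|) * 1 * |p.2|) ∂((gam.prod gam).prod gam) := by
        apply integral_mono hi.abs ((b1.add b2).add b3)
        intro p
        simp only [Pi.add_apply, Function.comp, abs_mul]
        have := abs_relu_le t ht p.1.1 p.1.2 p.2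
        have h2 := hq1 p.2
        by_cases hz : F p.1.1 = 0
        · simp [hz]
        have h3 := hF1 _ hz
        calc |F p.1.1| * |q p.2| * |max (t*p.1.1+√(1-t^2)*p.1.2+p.2) 0| ≤ |F p.1.1| * 1 * (|p.1.1|+|p.1.2|+|p.2|) := by gcongr
          _ ≤ |F p.1.1| * 1 * (|p.1.1| * (1+|p.1.2|+|p.2|)) := by
            gcongr; nlinarith [abs_nonneg p.1.2, abs_nonneg p.2]
          _ = _ := by ring
    _ ≤ _ := by
        have e1 := integral_prod_mul (μ := gam.prod gam) (ν := gam)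
          (fun p : ℝ×ℝ => (|F p.1| * |p.1|) * 1) (fun _ => (1:ℝ))
        have e2 := integral_prod_mul (μ := gam.prod gam) (ν := gam)
          (fun p : ℝ×ℝ => (|F p.1| * |p.1|) * |p.2|) (fun _ => (1:ℝ))
        have e3 := integral_prod_mul (μ := gam.prod gam) (ν := gam)
          (fun p : ℝ×ℝ => (|F p.1| * |p.1|) * 1) (fun b => |b|)
        have e4 := integral_prod_mul (μ := gam) (ν := gam) (fun u => |F u| * |u|) (fun _ => (1:ℝ))
        have e5 := integral_prod_mul (μ := gam) (ν := gam) (fun u => |F u| * |u|) (fun u => |u|)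
        have b12 : Integrable (fun p : (ℝ×ℝ)×ℝ => (|F p.1.1| * |p.1.1|) * 1 * 1 + (|F p.1.1| * |p.1.1|) * |p.1.2| * 1) ((gam.prod gam).prod gam) := b1.add b2
        rw [integral_add b12 b3, integral_add b1 b2, e1, e2, e3, e4, e5]
        have hA : 0 ≤ ∫ u, |F u| * |u| ∂gam := integral_nonneg fun u => by positivity
        have hB := int_abs_le
        simp only [integral_const, probReal_univ, smul_eq_mul, mul_one]
        nlinarith

lemma mehler (t : ℝ) (ht : |t| ≤ 1) (i : ℕ) (q : ℝ → ℝ) (hq : Measurable q)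
    (hq1 : ∀ b, |q b| ≤ 1) :
    ∫ p : (ℝ×ℝ)×ℝ, He i p.1.1 * q p.2 * max (p.1.2+p.2) 0 ∂(law3 t) =
      t^i * ∫ p : ℝ×ℝ, He i p.1 * (q p.2 * max (p.1+p.2) 0) ∂(gam.prod gam) := by
  have hHm : Measurable (He i) := (He_cont i).measurable
  have hm : Measurable (fun p : (ℝ×ℝ)×ℝ => He i p.1.1 * q p.2 * max (p.1.2+p.2) 0) := by fun_prop
  have hi := int_law3 t ht (He i) hHm q hq hq1 (He_int i) (He_int_mul i)
  rw [law3_rep2 t ht, integrable_map_measure hm.aestronglyMeasurable (by fun_prop)] at hi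
  rw [law3_rep2 t ht, integral_map (by fun_prop) hm.aestronglyMeasurable]
  have hts : t^2 + (√(1-t^2))^2 = 1 := by
    rw [Real.sq_sqrt (by nlinarith [abs_le.1 ht])]; ring
  have hi2 : Integrable (fun p : ℝ×ℝ => He i p.1 * (q p.2 * max (p.1+p.2) 0)) (gam.prod gam) := by
    have c1 : Integrable (fun _ : ℝ => (1:ℝ)) gam := integrable_const _
    have := ((He_int_mul i).mul_prod c1).add ((He_int i).abs.mul_prod int_id.abs)
    refine this.mono' (by fun_prop) (ae_of_all _ fun p => ?_)
    simp only [norm_mul, Real.norm_eq_abs, Pi.add_apply]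
    have h2 := hq1 p.2
    have h3 : |max (p.1+p.2) 0| ≤ |p.1|+|p.2| := by
      rw [abs_of_nonneg (le_max_right _ _)]
      exact max_le ((le_abs_self _).trans (abs_add_le _ _)) (by positivity)
    calc |He i p.1| * (|q p.2| * _) ≤ |He i p.1| * (1 * (|p.1|+|p.2|)) := by gcongr
      _ = _ := by ring
  have hi' : Integrable (fun p : (ℝ×ℝ)×ℝ => He i (t * p.1.1 + √(1 - t ^ 2) * p.1.2) * q p.2 * max (p.1.1 + p.2) 0)
    ((gam.prod gam).prod gam) := hi
  show ∫ p : (ℝ×ℝ)×ℝ, He i (t * p.1.1 + √(1 - t ^ 2) * p.1.2) * q p.2 * max (p.1.1 + p.2) 0 ∂((gam.prod gam).prod gam) = _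
  rw [integral_prod _ hi', integral_prod _ hi'.integral_prod_left, integral_prod _ hi2, ← integral_const_mul]
  congr 1; ext y
  simp only [mul_assoc]
  simp only [integral_const_mul]
  rw [integral_mul_const, He_avg t _ hts]
  ring

lemma two_int (i : ℕ) (q : ℝ → ℝ) (hq : Measurable q) (hq1 : ∀ b, |q b| ≤ 1) :
    Integrable (fun p : ℝ×ℝ => He i p.1 * (q p.2 * max (p.1+p.2) 0)) (gam.prod gam) := by
  have hHm : Measurable (He i) := (He_cont i).measurable
  have c1 : Integrable (fun _ : ℝ => (1:ℝ)) gam := integrable_const _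
  have := ((He_int_mul i).mul_prod c1).add ((He_int i).abs.mul_prod int_id.abs)
  refine this.mono' (by fun_prop) (ae_of_all _ fun p => ?_)
  simp only [norm_mul, Real.norm_eq_abs, Pi.add_apply]
  have h2 := hq1 p.2
  have h3 : |max (p.1+p.2) 0| ≤ |p.1|+|p.2| := by
    rw [abs_of_nonneg (le_max_right _ _)]
    exact max_le ((le_abs_self _).trans (abs_add_le _ _)) (by positivity)
  calc |He i p.1| * (|q p.2| * _) ≤ |He i p.1| * (1 * (|p.1|+|p.2|)) := by gcongr
    _ = _ := by ring

noncomputable def qn (n : ℕ) (b : ℝ) : ℝ := if b ≤ -(2*√n) then 1 else 0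

lemma qn_meas (n : ℕ) : Measurable (qn n) :=
  Measurable.ite (measurableSet_Iic) measurable_const measurable_const

lemma qn_le (n : ℕ) (b : ℝ) : |qn n b| ≤ 1 := by
  unfold qn; split_ifs <;> simp

noncomputable def kap (n : ℕ) : ℝ :=
  ∫ p : ℝ×ℝ, He (n+1) p.1 * (qn n p.2 * max (p.1+p.2) 0) ∂(gam.prod gam)

lemma kap_num (n : ℕ) : (√((n:ℝ)+1))^(n+1) / (4*600^(n+1)) ≤
    (√n+1/2)^(n+1) * (((2*√n+3/2)-(2*√n+1))*((√(2*Real.pi))⁻¹*Real.exp (-((2*√n+3/2)^2)/2)) *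
      ((-(2*√n)-(-(2*√n)-1/2))*((√(2*Real.pi))⁻¹*Real.exp (-((2*√n+1/2)^2)/2)))) := by
  have hs : √(n:ℝ)^2 = n := Real.sq_sqrt (by positivity)
  have hs0 : 0 ≤ √(n:ℝ) := Real.sqrt_nonneg _
  have hpi : √(2*Real.pi)^2 = 2*Real.pi := Real.sq_sqrt (by positivity)
  have e1 : Real.exp (-((2*√n+3/2)^2)/2) * Real.exp (-((2*√n+1/2)^2)/2) = Real.exp (-(4*n+4*√n+5/4)) := by
    rw [← Real.exp_add]; congr 1; nlinarith
  have e2 : (√(2*Real.pi))⁻¹ * (√(2*Real.pi))⁻¹ = (2*Real.pi)⁻¹ := by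
    rw [← mul_inv, ← sq, hpi]
  have e3 : (√n+1/2)^(n+1) * (((2*√n+3/2)-(2*√n+1))*((√(2*Real.pi))⁻¹*Real.exp (-((2*√n+3/2)^2)/2)) *
      ((-(2*√n)-(-(2*√n)-1/2))*((√(2*Real.pi))⁻¹*Real.exp (-((2*√n+1/2)^2)/2)))) =
      (√n+1/2)^(n+1) * (1/4 * (2*Real.pi)⁻¹ * Real.exp (-(4*n+4*√n+5/4))) := by
    rw [← e1, ← e2]; ring
  rw [e3]
  have h1 : 1/2 * (√((n:ℝ)+1))^(n+1) ≤ (√n+1/2)^(n+1) := by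
    rcases Nat.eq_zero_or_pos n with rfl | hn
    · simp
    · have : √((n:ℝ)+1) ≤ √n+1/2 := by
        have hn' : (1:ℝ) ≤ √n := Real.one_le_sqrt.2 (by exact_mod_cast hn)
        apply Real.sqrt_le_iff.2 ⟨by positivity, by nlinarith⟩
      have := pow_le_pow_left₀ (Real.sqrt_nonneg _) this (n+1)
      have : 0 ≤ (√((n:ℝ)+1))^(n+1) := by positivity
      linarith
  have h2 : 2 / 600^(n+1) ≤ (2*Real.pi)⁻¹ * Real.exp (-(4*n+4*√n+5/4)) := by
    have h3 : Real.exp (4*n+4*√n+5/4) ≤ 600^n * 27 := by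
      have he : Real.exp 1 ≤ 2.7183 := Real.exp_one_lt_d9.le.trans (by norm_num)
      have a1 : Real.exp 6 ≤ 600 := by
        have : Real.exp 6 = Real.exp 1 ^ 6 := by rw [← Real.exp_nat_mul]; norm_num
        rw [this]
        calc _ ≤ (2.7183:ℝ)^6 := by gcongr
          _ ≤ _ := by norm_num
      have a2 : Real.exp (13/4) ≤ 27 := by
        have : Real.exp (13/4) ^ 4 = Real.exp 1 ^ 13 := by
          rw [← Real.exp_nat_mul, ← Real.exp_nat_mul]; norm_num
        have h : Real.exp (13/4) ^ 4 ≤ 27^4 := by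
          rw [this]
          calc _ ≤ (2.7183:ℝ)^13 := by gcongr
            _ ≤ _ := by norm_num
        exact le_of_pow_le_pow_left₀ (by norm_num) (by norm_num) h
      calc _ ≤ Real.exp (n*6+13/4) := by
            apply Real.exp_le_exp.2; nlinarith [sq_nonneg (√(n:ℝ)-1)]
        _ = Real.exp 6 ^ n * Real.exp (13/4) := by rw [Real.exp_add, Real.exp_nat_mul]
        _ ≤ _ := by gcongr
    rw [Real.exp_neg, ← mul_inv, ← one_div]
    rw [div_le_div_iff₀ (by positivity) (by positivity)]
    have hp := Real.pi_lt_d2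
    have hp0 := Real.pi_pos
    have : (0:ℝ) < 600^n := by positivity
    rw [pow_succ]
    calc 2 * (2*Real.pi*Real.exp (4*n+4*√n+5/4)) ≤ 2*(2*3.15*(600^n*27)) := by gcongr
      _ ≤ _ := by nlinarith
  calc _ = (1/2 * (√((n:ℝ)+1))^(n+1)) * (1/4 * (2/600^(n+1))) := by ring
    _ ≤ (√n+1/2)^(n+1) * (1/4 * ((2*Real.pi)⁻¹ * Real.exp (-(4*n+4*√n+5/4)))) := by gcongr
    _ = _ := by ring

lemma kap_lower (n : ℕ) : (√((n:ℝ)+1))^(n+1) / (4*600^(n+1)) ≤ kap n := by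
  refine (kap_num n).trans ?_
  have hs : √(n:ℝ)^2 = n := Real.sq_sqrt (by positivity)
  have hs0 : 0 ≤ √(n:ℝ) := Real.sqrt_nonneg _
  set S : Set (ℝ×ℝ) := Set.Icc (2*√n+1) (2*√n+3/2) ×ˢ Set.Icc (-(2*√n)-1/2) (-(2*√n)) with hS
  have hSm : MeasurableSet S := measurableSet_Icc.prod measurableSet_Icc
  have g1 := gam_Icc (2*√n+1) (2*√n+3/2) (by linarith) (2*√n+3/2)
    (by rw [abs_of_nonneg (by positivity)]; linarith) (by rw [abs_of_nonneg (by positivity)])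
  have g2 := gam_Icc (-(2*√n)-1/2) (-(2*√n)) (by linarith) (2*√n+1/2)
    (by rw [abs_of_nonpos (by linarith)]; linarith) (by rw [abs_of_nonpos (by linarith)]; linarith)
  have hμ : (gam.prod gam).real S = gam.real (Set.Icc (2*√n+1) (2*√n+3/2)) *
      gam.real (Set.Icc (-(2*√n)-1/2) (-(2*√n))) := by
    rw [hS, measureReal_prod_prod]
  have hi := two_int (n+1) (qn n) (qn_meas n) (qn_le n)
  calc _ ≤ (√n+1/2)^(n+1) * (gam.prod gam).real S := by
        rw [hμ]
        gcongr
        exact mul_nonneg (by linarith) (by positivity)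
    _ = ∫ p, S.indicator (fun _ => (√n+1/2)^(n+1)) p ∂(gam.prod gam) := by
        rw [integral_indicator hSm, setIntegral_const, smul_eq_mul, mul_comm]
    _ ≤ _ := by
        apply integral_mono ((integrable_const _).indicator hSm) hi
        intro p
        by_cases hp : p ∈ S
        · rw [Set.indicator_of_mem hp]
          obtain ⟨⟨h1, h2⟩, h3, h4⟩ := hp
          have hl := He_lower n p.1 (by linarith) (by nlinarith)
          have : qn n p.2 = 1 := by simp [qn, h4]
          simp only [this, one_mul]
          have hm : 1/2 ≤ max (p.1+p.2) 0 := le_max_of_le_left (by linarith)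
          calc (√n+1/2)^(n+1) ≤ (p.1/2)^(n+1) := by gcongr; linarith
            _ = (2*(p.1/2)^(n+1)) * (1/2) := by ring
            _ ≤ _ := by
              have : 0 ≤ p.1/2 := by linarith
              gcongr
              exact le_trans (by positivity) hl
        · rw [Set.indicator_of_notMem hp]
          simp only [qn]
          split_ifs with hb
          · rcases le_or_gt (p.1+p.2) 0 with h0 | h0
            · simp [max_eq_right h0]
            · have hl := He_lower n p.1 (by linarith) (by nlinarith)
              have : 0 ≤ p.1/2 := by linarith
              have h2 : 0 ≤ He (n+1) p.1 := le_trans (by positivity) hl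
              positivity
          · simp

lemma kap_pos (n : ℕ) : 0 < kap n := lt_of_lt_of_le (by positivity) (kap_lower n)

lemma tail_pt (n : ℕ) (ε : ℝ) (he : 0 < ε) (u : ℝ) (hu : 32*((n+1:ℝ) + Real.log (1/ε)) ≤ u^2)
   (hL : 0 ≤ Real.log (1/ε)) :
    |He (n+1) u| / kap n * |u| ≤ 16 * ε^8 * Real.exp (7/16*u^2) := by
  have hi : (0:ℝ) < n+1 := by positivity
  have hs : √((n:ℝ)+1)^2 = n+1 := Real.sq_sqrt (by positivity)
  have hs0 : 0 < √((n:ℝ)+1) := Real.sqrt_pos.2 hi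
  have h1 := He_upper |u| (n+1) (by push_cast; rw [sq_abs]; nlinarith) (abs_nonneg u) u le_rfl
  have h2 : (|u|/(2*√((n:ℝ)+1)))^(n+1) ≤ Real.exp (u^2/8) := by
    apply le_of_pow_le_pow_left₀ (n := 2) (by norm_num) (by positivity)
    rw [← pow_mul, mul_comm (n+1) 2, pow_mul, ← Real.exp_nat_mul, div_pow, mul_pow, hs, sq_abs]
    calc (u^2/(2^2*((n:ℝ)+1)))^(n+1) ≤ (Real.exp (u^2/(2^2*((n:ℝ)+1))))^(n+1) := by
          gcongr; linarith [Real.add_one_le_exp (u^2/(2^2*((n:ℝ)+1)))]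
      _ = _ := by rw [← Real.exp_nat_mul]; congr 1; push_cast; field_simp; norm_num
  have h3 : (2400:ℝ)^(n+1) ≤ Real.exp (u^2/4) * ε^8 := by
    have he1 : 2.7 ≤ Real.exp 1 := le_trans (by norm_num) Real.exp_one_gt_d9.le
    have a : (2400:ℝ) ≤ Real.exp 8 := by
      have : Real.exp 8 = Real.exp 1 ^ 8 := by rw [← Real.exp_nat_mul]; norm_num
      rw [this]
      calc (2400:ℝ) ≤ 2.7^8 := by norm_num
        _ ≤ _ := by gcongr
    have e : Real.exp (-(8*Real.log (1/ε))) = ε^8 := by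
      rw [one_div, Real.log_inv, show -(8*(-Real.log ε)) = (8:ℕ)*Real.log ε by push_cast; ring, Real.exp_nat_mul, Real.exp_log he]
    calc (2400:ℝ)^(n+1) ≤ Real.exp 8 ^ (n+1) := by gcongr
      _ = Real.exp ((n+1:ℝ)*8) := by rw [← Real.exp_nat_mul]; push_cast; rfl
      _ ≤ Real.exp (u^2/4 + -(8*Real.log (1/ε))) := by apply Real.exp_le_exp.2; linarith
      _ = _ := by rw [Real.exp_add, e]
  have h4 : |u| ≤ 4*Real.exp (u^2/16) := by
    have := Real.add_one_le_exp (u^2/16)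
    rw [← sq_abs] at this ⊢
    nlinarith [sq_nonneg (|u|/2-1)]
  have hk := kap_lower n
  calc |He (n+1) u| / kap n * |u| ≤ (2*|u|)^(n+1) / ((√((n:ℝ)+1))^(n+1) / (4*600^(n+1))) * (4*Real.exp (u^2/16)) := by
        gcongr
    _ = 16 * 2400^(n+1) * (|u|/(2*√((n:ℝ)+1)))^(n+1) * Real.exp (u^2/16) := by
        rw [show (2400:ℝ) = 2*(2*600) by norm_num, mul_pow, mul_pow, mul_pow, div_pow, mul_pow]
        field_simp
        ring
    _ ≤ 16 * (Real.exp (u^2/4) * ε^8) * Real.exp (u^2/8) * Real.exp (u^2/16) := by gcongr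
    _ = 16 * ε^8 * (Real.exp (u^2/4) * Real.exp (u^2/8) * Real.exp (u^2/16)) := by ring
    _ = _ := by rw [← Real.exp_add, ← Real.exp_add]; congr 2; ring

lemma sup_pt (n : ℕ) (L : ℝ) (hL : 0 ≤ L) (u : ℝ) (hu : |u| ≤ √(32*((n+1:ℝ)+L))) :
    |He (n+1) u| / kap n ≤ 4*((10^4:ℝ)^(n+1) + (√L/√((n:ℝ)+1)*10^4)^(n+1)) := by
  have hi : (0:ℝ) < n+1 := by positivity
  have hs : √((n:ℝ)+1)^2 = n+1 := Real.sq_sqrt (by positivity)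
  have hs0 : 0 < √((n:ℝ)+1) := Real.sqrt_pos.2 hi
  set B := √(32*((n+1:ℝ)+L)) with hB
  have hB2 : B^2 = 32*((n+1:ℝ)+L) := Real.sq_sqrt (by positivity)
  have hB0 : 0 ≤ B := Real.sqrt_nonneg _
  have h1 := He_upper B (n+1) (by push_cast; rw [hB2]; nlinarith) hB0 u hu
  have hk := kap_lower n
  have hL2 : √L^2 = L := Real.sq_sqrt hL
  have h2 : B/√((n:ℝ)+1) ≤ 8 * max 1 (√L/√((n:ℝ)+1)) := by
    rw [div_le_iff₀ hs0, mul_assoc, max_mul_of_nonneg _ _ hs0.le, div_mul_cancel₀ _ hs0.ne', one_mul]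
    have m1 := le_max_left (√((n:ℝ)+1)) (√L)
    have m2 := le_max_right (√((n:ℝ)+1)) (√L)
    have := Real.sqrt_nonneg L
    apply abs_le_of_sq_le_sq' _ (by positivity) |>.2
    rw [hB2]; nlinarith
  calc |He (n+1) u| / kap n ≤ (2*B)^(n+1) / ((√((n:ℝ)+1))^(n+1) / (4*600^(n+1))) := by gcongr
    _ = 4 * (1200*(B/√((n:ℝ)+1)))^(n+1) := by
        rw [show (1200:ℝ) = 2*600 by norm_num, mul_pow, mul_pow, div_pow, mul_pow]
        field_simp
    _ ≤ 4 * (1200*(8 * max 1 (√L/√((n:ℝ)+1))))^(n+1) := by gcongr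
    _ ≤ 4 * (max 1 (√L/√((n:ℝ)+1))*10^4)^(n+1) := by
        gcongr 4 * ?_ ^ (n+1)
        nlinarith [le_max_left 1 (√L/√((n:ℝ)+1))]
    _ ≤ _ := by
        gcongr
        have p1 : 0 ≤ (10^4:ℝ)^(n+1) := by positivity
        have p2 : 0 ≤ (√L/√((n:ℝ)+1)*10^4)^(n+1) := by positivity
        rcases max_choice 1 (√L/√((n:ℝ)+1)) with h | h
        · rw [h, one_mul]; exact le_add_of_nonneg_right p2
        · rw [h]; exact le_add_of_nonneg_left p1

lemma mono_succ (n : ℕ) (ε : ℝ) (he : 0 < ε) (he1 : ε < 1) :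
    ∃ F q : ℝ → ℝ, Measurable F ∧ Measurable q ∧
      (∀ u b, |F u * q b| ≤ 10*((10^4:ℝ)^(n+1) + (√(Real.log (1/ε))/√((n:ℝ)+1)*10^4)^(n+1))) ∧
      ∀ t : ℝ, |t| ≤ 1 →
        |∫ p : (ℝ×ℝ)×ℝ, F p.1.1 * q p.2 * max (p.1.2+p.2) 0 ∂(law3 t) - t^(n+1)| ≤ 200 * ε^2 := by
  have hL : 0 ≤ Real.log (1/ε) := Real.log_nonneg (by rw [le_div_iff₀ he]; linarith)
  set L := Real.log (1/ε) with hLd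
  set B := √(32*((n+1:ℝ)+L)) with hB
  have hB2 : B^2 = 32*((n+1:ℝ)+L) := Real.sq_sqrt (by positivity)
  have hB0 : 0 ≤ B := Real.sqrt_nonneg _
  have hHm : Measurable (He (n+1)) := (He_cont (n+1)).measurable
  have hms : MeasurableSet {u : ℝ | |u| ≤ B} := measurableSet_le (by fun_prop) (by fun_prop)
  have hkp := kap_pos n
  have hB1 : 1 ≤ B := by
    by_contra hcon
    push Not at hcon
    have : (0:ℝ) ≤ n := by positivity
    nlinarith
  set F : ℝ → ℝ := fun u => if |u| ≤ B then He (n+1) u / kap n else 0 with hF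
  set G : ℝ → ℝ := fun u => if |u| ≤ B then 0 else He (n+1) u / kap n with hG
  have hFm : Measurable F := Measurable.ite hms (by fun_prop) measurable_const
  have hGm : Measurable G := Measurable.ite hms measurable_const (by fun_prop)
  refine ⟨F, qn n, hFm, qn_meas n, ?_, ?_⟩
  · intro u b
    have hq := qn_le n b
    have p2 : 0 ≤ ((10^4:ℝ)^(n+1) + (√L/√((n:ℝ)+1)*10^4)^(n+1)) := by positivity
    have : |F u| ≤ 4*((10^4:ℝ)^(n+1) + (√L/√((n:ℝ)+1)*10^4)^(n+1)) := by
      simp only [hF]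
      split_ifs with h
      · rw [abs_div, abs_of_pos hkp]; exact sup_pt n L hL u h
      · rw [abs_zero]; positivity
    rw [abs_mul]
    calc |F u| * |qn n b| ≤ |F u| * 1 := by gcongr
      _ ≤ _ := by linarith
  · intro t ht
    have hGi : ∀ u, |G u| ≤ |He (n+1) u| / kap n := by
      intro u
      simp only [hG]
      split_ifs
      · rw [abs_zero]; positivity
      · rw [abs_div, abs_of_pos hkp]
    have hGt : ∀ u, |G u| * |u| ≤ 16 * ε^8 * Real.exp (7/16*u^2) := by
      intro u
      simp only [hG]
      split_ifs with h
      · rw [abs_zero, zero_mul]; positivity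
      · rw [abs_div, abs_of_pos hkp]
        apply tail_pt n ε he u _ hL
        rw [← hB2, ← sq_abs u]
        push Not at h
        gcongr
    have hG0 : Integrable G gam := ((He_int (n+1)).abs.div_const (kap n)).mono'
      hGm.aestronglyMeasurable (ae_of_all _ hGi)
    have hG1 : Integrable (fun u => |G u| * |u|) gam := by
      refine (gam_exp_sq.1.const_mul (16*ε^8)).mono' (by fun_prop) (ae_of_all _ fun u => ?_)
      rw [Real.norm_eq_abs, abs_of_nonneg (by positivity)]
      exact hGt u
    have hH0 : Integrable (fun u => He (n+1) u / kap n) gam := (He_int (n+1)).div_const _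
    have hH1 : Integrable (fun u => |He (n+1) u / kap n| * |u|) gam := by
      refine ((He_int_mul (n+1)).div_const (kap n)).congr (ae_of_all _ fun u => ?_)
      simp only [abs_div, abs_of_pos hkp]; ring
    have i1 := int_law3 t ht G hGm (qn n) (qn_meas n) (qn_le n) hG0 hG1
    have i2 := int_law3 t ht _ (hHm.div_const (kap n)) (qn n) (qn_meas n) (qn_le n) hH0 hH1
    have hsum : ∫ p : (ℝ×ℝ)×ℝ, F p.1.1 * qn n p.2 * max (p.1.2+p.2) 0 ∂(law3 t) =
        t^(n+1) - ∫ p : (ℝ×ℝ)×ℝ, G p.1.1 * qn n p.2 * max (p.1.2+p.2) 0 ∂(law3 t) := by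
      have hm := mehler t ht (n+1) (qn n) (qn_meas n) (qn_le n)
      have : ∫ p : (ℝ×ℝ)×ℝ, He (n+1) p.1.1 / kap n * qn n p.2 * max (p.1.2+p.2) 0 ∂(law3 t) = t^(n+1) := by
        have e : (fun p : (ℝ×ℝ)×ℝ => He (n+1) p.1.1 / kap n * qn n p.2 * max (p.1.2+p.2) 0) =
          fun p => (He (n+1) p.1.1 * qn n p.2 * max (p.1.2+p.2) 0) / kap n := by
          funext p; ring
        rw [e, integral_div, hm]
        exact mul_div_cancel_right₀ _ hkp.ne'
      rw [← this, ← integral_sub i2 i1]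
      congr 1; funext p
      simp only [hF, hG]
      split_ifs <;> ring
    rw [hsum, sub_sub_cancel_left, abs_neg]
    refine (tail_law3 t ht G hGm (qn n) (qn_meas n) (qn_le n) hG0 hG1 ?_).trans ?_
    · intro u hu
      simp only [hG] at hu
      split_ifs at hu with h
      · exact absurd rfl hu
      · push Not at h; linarith
    · have : ∫ u, |G u| * |u| ∂gam ≤ 16*ε^8*3 := by
        calc _ ≤ ∫ u, 16*ε^8*Real.exp (7/16*u^2) ∂gam := integral_mono hG1 (gam_exp_sq.1.const_mul _) hGt
          _ = 16*ε^8 * ∫ u, Real.exp (7/16*u^2) ∂gam := integral_const_mul _ _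
          _ ≤ _ := by gcongr; exact gam_exp_sq.2
      have h8 : ε^8 ≤ ε^2 := pow_le_pow_of_le_one he.le he1.le (by norm_num)
      have : 0 ≤ ε^2 := by positivity
      linarith

lemma mono_zero : ∃ F q : ℝ → ℝ, Measurable F ∧ Measurable q ∧
      (∀ u b, |F u * q b| ≤ 20) ∧
      ∀ t : ℝ, |t| ≤ 1 →
        ∫ p : (ℝ×ℝ)×ℝ, F p.1.1 * q p.2 * max (p.1.2+p.2) 0 ∂(law3 t) = 1 := by
  set q : ℝ → ℝ := fun b => if b ∈ Set.Icc (1/2:ℝ) (3/2) then 1 else 0 with hq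
  have hqm : Measurable q := Measurable.ite measurableSet_Icc measurable_const measurable_const
  have hq1 : ∀ b, |q b| ≤ 1 := by intro b; simp only [hq]; split_ifs <;> simp
  set κ := ∫ p : ℝ×ℝ, He 0 p.1 * (q p.2 * max (p.1+p.2) 0) ∂(gam.prod gam) with hκ
  have hk : 1/20 ≤ κ := by
    have hi := two_int 0 q hqm hq1
    have hqi : Integrable q gam := (integrable_const (1:ℝ)).mono' hqm.aestronglyMeasurable (ae_of_all _ hq1)
    have hqbi : Integrable (fun b => q b * b) gam := int_id.abs.mono' (by fun_prop) (ae_of_all _ fun b => by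
      simp only [norm_mul, Real.norm_eq_abs]; nlinarith [hq1 b, abs_nonneg b])
    have c1 : Integrable (fun _ : ℝ => (1:ℝ)) gam := integrable_const _
    have j1 := int_id.mul_prod hqi
    have j2 := c1.mul_prod hqbi
    have hint0 : ∫ x : ℝ, x ∂gam = 0 := by simp [gam, integral_id_gaussianReal]
    have e1 := integral_prod_mul (μ := gam) (ν := gam) (fun u => u) q
    have e2 := integral_prod_mul (μ := gam) (ν := gam) (fun _ => (1:ℝ)) (fun b => q b * b)
    have hg := gam_Icc (1/2) (3/2) (by norm_num) (3/2) (by norm_num [abs_le]) (by norm_num [abs_le])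
    have hlow : ∫ b, q b * b ∂gam ≤ κ := by
      calc _ = ∫ p : ℝ×ℝ, (p.1 * q p.2 + 1 * (q p.2 * p.2)) ∂(gam.prod gam) := by
            rw [integral_add j1 j2, e1, e2, hint0]; simp
        _ ≤ _ := by
            apply integral_mono (j1.add j2) hi
            intro p
            simp only [He_zero, Pi.add_apply]
            have : 0 ≤ q p.2 := by simp only [hq]; split_ifs <;> simp
            nlinarith [le_max_left (p.1+p.2) 0]
    have hlow2 : 1/2 * gam.real (Set.Icc (1/2) (3/2)) ≤ ∫ b, q b * b ∂gam := by
      calc _ = ∫ b, (Set.Icc (1/2:ℝ) (3/2)).indicator (fun _ => (1/2:ℝ)) b ∂gam := by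
            rw [integral_indicator measurableSet_Icc, setIntegral_const, smul_eq_mul, mul_comm]
        _ ≤ _ := by
            apply integral_mono ((integrable_const _).indicator measurableSet_Icc) hqbi
            intro b
            by_cases hb : b ∈ Set.Icc (1/2:ℝ) (3/2)
            · rw [Set.indicator_of_mem hb]; simp only [hq, if_pos hb]; linarith [hb.1]
            · rw [Set.indicator_of_notMem hb]; simp only [hq, if_neg hb]; simp
    have hnum : 1/10 ≤ (3/2-1/2:ℝ)*((√(2*Real.pi))⁻¹*Real.exp (-((3/2)^2)/2)) := by
      have hp : √(2*Real.pi) ≤ 2.52 := Real.sqrt_le_iff.2 ⟨by norm_num, by nlinarith [Real.pi_lt_d2]⟩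
      have hp0 : 0 < √(2*Real.pi) := by positivity
      have he : Real.exp 1 ≤ 2.7183 := Real.exp_one_lt_d9.le.trans (by norm_num)
      have a2 : Real.exp (9/8) ≤ 3.2 := by
        have : Real.exp (9/8) ^ 8 = Real.exp 1 ^ 9 := by
          rw [← Real.exp_nat_mul, ← Real.exp_nat_mul]; norm_num
        have h : Real.exp (9/8) ^ 8 ≤ 3.2^8 := by
          rw [this]
          calc _ ≤ (2.7183:ℝ)^9 := by gcongr
            _ ≤ _ := by norm_num
        exact le_of_pow_le_pow_left₀ (by norm_num) (by norm_num) h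
      rw [show -((3/2:ℝ)^2)/2 = -(9/8) by norm_num, Real.exp_neg, ← mul_inv]
      rw [show (3/2-1/2:ℝ) = 1 by norm_num, one_mul, one_div]
      apply inv_anti₀ (by positivity)
      calc √(2*Real.pi) * Real.exp (9/8) ≤ 2.52*3.2 := by gcongr
        _ ≤ 10 := by norm_num
    linarith
  refine ⟨fun _ => 1/κ, q, measurable_const, hqm, ?_, ?_⟩
  · intro u b
    rw [abs_mul, abs_of_pos (by positivity)]
    calc 1/κ * |q b| ≤ 1/(1/20) * 1 := by gcongr; exact hq1 b
      _ = 20 := by norm_num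
  · intro t ht
    have hm := mehler t ht 0 q hqm hq1
    have e : (fun p : (ℝ×ℝ)×ℝ => 1/κ * q p.2 * max (p.1.2+p.2) 0) =
          fun p => (He 0 p.1.1 * q p.2 * max (p.1.2+p.2) 0) / κ := by
          funext p; simp only [He_zero]; ring
    rw [e, integral_div, hm, pow_zero, one_mul]
    exact div_self (by positivity)

lemma mono (i : ℕ) (ε : ℝ) (he : 0 < ε) (he1 : ε < 1) :
    ∃ F q : ℝ → ℝ, Measurable F ∧ Measurable q ∧
      (∀ u b, |F u * q b| ≤ 10*((10^4:ℝ)^i + (√(Real.log (1/ε))/√(i:ℝ)*10^4)^i)) ∧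
      ∀ t : ℝ, |t| ≤ 1 →
        |∫ p : (ℝ×ℝ)×ℝ, F p.1.1 * q p.2 * max (p.1.2+p.2) 0 ∂(law3 t) - t^i| ≤ 200 * ε^2 := by
  cases i with
  | zero =>
    obtain ⟨F, q, h1, h2, h3, h4⟩ := mono_zero
    refine ⟨F, q, h1, h2, fun u b => (h3 u b).trans (by norm_num), fun t ht => ?_⟩
    rw [h4 t ht]; simp; positivity
  | succ n =>
    push_cast
    exact mono_succ n ε he he1

lemma relu_int_law3 (t : ℝ) (ht : |t| ≤ 1) :
    Integrable (fun p : (ℝ×ℝ)×ℝ => max (p.1.2+p.2) 0) (law3 t) := by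
  have h := int_law3 t ht (fun _ => 1) measurable_const (fun _ => 1) measurable_const (by simp)
    (integrable_const _) (by simpa using int_id.abs)
  simpa using h

lemma bdd_int_law3 (t : ℝ) (ht : |t| ≤ 1) (G : (ℝ×ℝ)×ℝ → ℝ) (hG : Measurable G) (M : ℝ)
    (hM : ∀ p, |G p| ≤ M) :
    Integrable (fun p : (ℝ×ℝ)×ℝ => G p * max (p.1.2+p.2) 0) (law3 t) :=
  (relu_int_law3 t ht).bdd_mul hG.aestronglyMeasurable (ae_of_all _ hM)

lemma cs_facts (co : ℕ → ℝ) (hs : Summable (csSummand co 1)) (ε : ℝ) (he : 0 < ε)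
    (he2 : ε < 1 / csOf co 1) :
    Summable (fun i => |co i|) ∧ (∑' i, |co i|) * (10^4*ε) ≤ 1 ∧ ∃ i, co i ≠ 0 := by
  have hle : ∀ i, |co i| ≤ csSummand co 1 i := by
    intro i
    unfold csSummand
    rw [one_pow, mul_one]
    have : (1:ℝ) ≤ ((i:ℝ)+1)^(1.75:ℝ) := Real.one_le_rpow (by linarith [Nat.cast_nonneg (α := ℝ) i]) (by norm_num)
    nlinarith [abs_nonneg (co i)]
  have hsum : Summable (fun i => |co i|) := Summable.of_nonneg_of_le (fun i => abs_nonneg _) hle hs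
  have hA : ∑' i, |co i| ≤ ∑' i, csSummand co 1 i := hsum.tsum_le_tsum hle hs
  have hpos : 0 < csOf co 1 := by
    by_contra hcon
    push Not at hcon
    have : 1 / csOf co 1 ≤ 0 := div_nonpos_of_nonneg_of_nonpos zero_le_one hcon
    linarith
  refine ⟨hsum, ?_, ?_⟩
  · rw [lt_div_iff₀ hpos] at he2
    unfold csOf Cstar at he2
    nlinarith
  · by_contra hcon
    push Not at hcon
    have : csOf co 1 = 0 := by simp [csOf, csSummand, hcon]
    linarith

lemma ce_pos (co : ℕ → ℝ) (ε : ℝ) (hs : Summable (ceSummand co 1 ε)) (h : ∃ i, co i ≠ 0) :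
    0 < ceOf co 1 ε := by
  obtain ⟨i, hi⟩ := h
  have h0 : ∀ i, 0 ≤ ceSummand co 1 ε i := by
    intro i; unfold ceSummand Cstar; positivity
  refine hs.tsum_pos h0 i ?_
  unfold ceSummand Cstar
  have : 0 < |co i| := abs_pos.2 hi
  positivity

lemma exists_h (co : ℕ → ℝ) (hs : Summable (csSummand co 1)) (ε : ℝ) (he : 0 < ε)
    (he2 : ε < 1 / csOf co 1) (hce : Summable (ceSummand co 1 ε)) :
    ∃ h : ℝ → ℝ → ℝ, Measurable (Function.uncurry h) ∧ (∀ u b, |h u b| ≤ 1) ∧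
      ∀ t : ℝ, |t| ≤ 1 → |10 * ceOf co 1 ε *
        ∫ p : (ℝ×ℝ)×ℝ, h p.1.1 p.2 * max (p.1.2+p.2) 0 ∂(law3 t) - psVal co t| ≤ ε := by
  obtain ⟨hsum, hA, hne⟩ := cs_facts co hs ε he he2
  have hC := ce_pos co ε hce hne
  set C := ceOf co 1 ε with hCd
  set A := ∑' i, |co i| with hAd
  have hA0 : 0 ≤ A := tsum_nonneg fun i => abs_nonneg _
  have habs : ∀ t : ℝ, |t| ≤ 1 → ∀ i, |co i * t^i| ≤ |co i| := by
    intro t ht i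
    rw [abs_mul, abs_pow]
    exact mul_le_of_le_one_right (abs_nonneg _) (pow_le_one₀ (abs_nonneg _) ht)
  have hsa : ∀ t : ℝ, |t| ≤ 1 → Summable (fun i => co i * t^i) := fun t ht =>
    Summable.of_norm_bounded hsum (habs t ht)
  rcases le_or_gt 1 ε with h1 | h1
  · refine ⟨fun _ _ => 0, by exact measurable_const, by simp, fun t ht => ?_⟩
    simp only [zero_mul, integral_zero, mul_zero, zero_sub, abs_neg]
    have : |psVal co t| ≤ A := tsum_of_norm_bounded (f := fun i => co i * t^i) hsum.hasSum (habs t ht)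
    nlinarith
  choose F q hF hq hb hi using fun i => mono i ε he h1
  obtain ⟨N, hN⟩ : ∃ N, ∑' k, |co (k+N)| ≤ ε/2 := by
    have := tendsto_sum_nat_add (fun i => |co i|)
    exact ((this.eventually (ge_mem_nhds (show (0:ℝ) < ε/2 by positivity))).exists)
  refine ⟨fun u b => (∑ i ∈ Finset.range N, co i * (F i u * q i b)) / (10*C), ?_, ?_, ?_⟩
  · apply Measurable.div_const
    apply Finset.measurable_sum
    intro i _
    have := hF i
    have := hq i
    fun_prop
  · intro u b
    rw [abs_div, abs_of_pos (by positivity : 0 < 10*C), div_le_one (by positivity)]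
    calc _ ≤ ∑ i ∈ Finset.range N, |co i * (F i u * q i b)| := Finset.abs_sum_le_sum_abs _ _
      _ ≤ ∑ i ∈ Finset.range N, 10 * ceSummand co 1 ε i := by
        apply Finset.sum_le_sum
        intro i _
        rw [abs_mul]
        unfold ceSummand Cstar
        rw [mul_one]
        refine (mul_le_mul_of_nonneg_left (hb i u b) (abs_nonneg _)).trans (le_of_eq ?_)
        ring
      _ = 10 * ∑ i ∈ Finset.range N, ceSummand co 1 ε i := by rw [Finset.mul_sum]
      _ ≤ 10 * C := by
        gcongr
        apply hce.sum_le_tsum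
        intro i _; unfold ceSummand Cstar; positivity
  · intro t ht
    have e : 10 * C * ∫ p : (ℝ×ℝ)×ℝ, (∑ i ∈ Finset.range N, co i * (F i p.1.1 * q i p.2)) / (10*C) * max (p.1.2+p.2) 0 ∂(law3 t)
        = ∑ i ∈ Finset.range N, co i * ∫ p : (ℝ×ℝ)×ℝ, F i p.1.1 * q i p.2 * max (p.1.2+p.2) 0 ∂(law3 t) := by
      rw [← integral_const_mul]
      have e2 : (fun p : (ℝ×ℝ)×ℝ => 10 * C * ((∑ i ∈ Finset.range N, co i * (F i p.1.1 * q i p.2)) / (10*C) * max (p.1.2+p.2) 0)) =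
          fun p => ∑ i ∈ Finset.range N, co i * (F i p.1.1 * q i p.2 * max (p.1.2+p.2) 0) := by
        funext p
        rw [show ∀ s m : ℝ, 10*C*(s/(10*C)*m) = s*m from fun s m => by field_simp, Finset.sum_mul]
        exact Finset.sum_congr rfl fun i _ => by ring
      rw [e2, integral_finsetSum]
      · exact Finset.sum_congr rfl fun i _ => integral_const_mul _ _
      · intro i _
        apply Integrable.const_mul
        have := hF i
        have := hq i
        exact bdd_int_law3 t ht (fun p => F i p.1.1 * q i p.2) (by fun_prop) _ (fun p => hb i _ _)
    rw [e]
    have hps : psVal co t = ∑ i ∈ Finset.range N, co i * t^i + ∑' k, co (k+N) * t^(k+N) :=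
      ((hsa t ht).sum_add_tsum_nat_add N).symm
    have htail : |∑' k, co (k+N) * t^(k+N)| ≤ ε/2 := by
      refine le_trans ?_ hN
      exact tsum_of_norm_bounded (f := fun k => co (k+N) * t^(k+N)) ((summable_nat_add_iff N).2 hsum).hasSum (fun k => habs t ht (k+N))
    have hmain : |∑ i ∈ Finset.range N, co i * ∫ p : (ℝ×ℝ)×ℝ, F i p.1.1 * q i p.2 * max (p.1.2+p.2) 0 ∂(law3 t) -
        ∑ i ∈ Finset.range N, co i * t^i| ≤ ε/2 := by
      rw [← Finset.sum_sub_distrib]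
      calc _ ≤ ∑ i ∈ Finset.range N, |co i * ∫ p : (ℝ×ℝ)×ℝ, F i p.1.1 * q i p.2 * max (p.1.2+p.2) 0 ∂(law3 t) - co i * t^i| := Finset.abs_sum_le_sum_abs _ _
        _ ≤ ∑ i ∈ Finset.range N, |co i| * (200*ε^2) := by
          apply Finset.sum_le_sum
          intro i _
          rw [← mul_sub, abs_mul]
          gcongr
          exact hi i t ht
        _ ≤ A * (200*ε^2) := by
          rw [← Finset.sum_mul]
          gcongr
          exact hsum.sum_le_tsum _ fun i _ => abs_nonneg _
        _ ≤ _ := by nlinarith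
    rw [hps, abs_le]
    rw [abs_le] at htail hmain
    constructor <;> linarith [htail.1, htail.2, hmain.1, hmain.2]

section GI
variable {Ω' : Type*} [MeasurableSpace Ω'] {m : ℕ} (P : Measure Ω') [IsProbabilityMeasure P]
  (s : NNReal) (a w : Ω' → Fin m → ℝ)

lemma gi_cf (ha : Measurable a) (hw : Measurable w) (k2 : ℝ) (hk : ∀ ω, ∑ r, a ω r^2 = k2)
    (haw : ∀ ω, ∑ r, a ω r * w ω r = 0) (α β : ℝ) :
    ∫ ω, Complex.exp (((α * (∑ r, ω.1 r * a ω.2 r) + β * (∑ r, ω.1 r * w ω.2 r) : ℝ):ℂ) * Complex.I)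
      ∂((Measure.pi fun _ : Fin m => gaussianReal 0 s).prod P) =
    Complex.exp (((-(s*(α^2*k2)/2) :ℝ):ℂ)) * ∫ ω, Complex.exp (((-(s*(β^2*∑ r, w ω r^2)/2) :ℝ):ℂ)) ∂P := by
  have ha' : ∀ r, Measurable fun ω => a ω r := fun r => (measurable_pi_apply r).comp ha
  have hw' : ∀ r, Measurable fun ω => w ω r := fun r => (measurable_pi_apply r).comp hw
  have hm1 : Measurable fun ω : (Fin m → ℝ) × Ω' => ∑ r, ω.1 r * a ω.2 r :=
    Finset.measurable_sum _ fun r _ => ((measurable_pi_apply r).comp measurable_fst).mul ((ha' r).comp measurable_snd)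
  have hm2 : Measurable fun ω : (Fin m → ℝ) × Ω' => ∑ r, ω.1 r * w ω.2 r :=
    Finset.measurable_sum _ fun r _ => ((measurable_pi_apply r).comp measurable_fst).mul ((hw' r).comp measurable_snd)
  rw [integral_prod_symm]
  · rw [← integral_const_mul]
    congr 1; funext ω
    have e : ∀ v : Fin m → ℝ, α * (∑ r, v r * a ω r) + β * (∑ r, v r * w ω r) =
        ∑ r, (α * a ω r + β * w ω r) * v r := by
      intro v
      rw [Finset.mul_sum, Finset.mul_sum, ← Finset.sum_add_distrib]
      exact Finset.sum_congr rfl fun r _ => by ring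
    simp only [e]
    rw [cf_pi, ← Complex.exp_add, ← Complex.ofReal_add]
    congr 2
    have : ∑ r, (α * a ω r + β * w ω r)^2 = α^2*k2 + β^2*∑ r, w ω r^2 := by
      have h0 := haw ω
      rw [← hk ω, Finset.mul_sum, Finset.mul_sum, ← Finset.sum_add_distrib]
      have : ∑ r, (α * a ω r + β * w ω r)^2 = ∑ r, (α^2*a ω r^2 + β^2*w ω r^2) + 2*α*β*∑ r, a ω r * w ω r := by
        rw [Finset.mul_sum, ← Finset.sum_add_distrib]
        exact Finset.sum_congr rfl fun r _ => by ring
      rw [this, h0]; ring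
    rw [this]; ring
  · refine (integrable_const (1:ℝ)).mono' ?_ (ae_of_all _ fun ω => ?_)
    · exact Measurable.aestronglyMeasurable (by fun_prop)
    · rw [Complex.norm_exp_ofReal_mul_I]

lemma gi_map (ha : Measurable a) (k2 : ℝ) (hk : ∀ ω, ∑ r, a ω r^2 = k2) (v : NNReal) (hv : (v:ℝ) = s*k2) :
    ((Measure.pi fun _ : Fin m => gaussianReal 0 s).prod P).map (fun ω => ∑ r, ω.1 r * a ω.2 r)
      = gaussianReal 0 v := by
  have ha' : ∀ r, Measurable fun ω => a ω r := fun r => (measurable_pi_apply r).comp ha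
  have hm1 : Measurable fun ω : (Fin m → ℝ) × Ω' => ∑ r, ω.1 r * a ω.2 r :=
    Finset.measurable_sum _ fun r _ => ((measurable_pi_apply r).comp measurable_fst).mul ((ha' r).comp measurable_snd)
  have : IsProbabilityMeasure (((Measure.pi fun _ : Fin m => gaussianReal 0 s).prod P).map (fun ω => ∑ r, ω.1 r * a ω.2 r)) :=
    Measure.isProbabilityMeasure_map hm1.aemeasurable
  apply Measure.ext_of_charFun
  funext t
  have h := gi_cf P s a (fun _ _ => 0) ha measurable_const k2 hk (by simp) t 0
  have h2 := cf_gauss v t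
  rw [charFun_apply_real, charFun_apply_real, integral_map hm1.aemeasurable (by fun_prop)]
  push_cast at h h2 ⊢
  rw [h2]
  simp only [zero_mul, add_zero, mul_zero] at h
  rw [h]
  simp
  have : (v:ℂ) = s*k2 := by exact_mod_cast congrArg Complex.ofReal hv
  rw [this]; ring_nf

lemma gi_indep (ha : Measurable a) (hw : Measurable w) (k2 : ℝ) (hk : ∀ ω, ∑ r, a ω r^2 = k2)
    (haw : ∀ ω, ∑ r, a ω r * w ω r = 0) :
    IndepFun (fun ω : (Fin m → ℝ) × Ω' => ∑ r, ω.1 r * a ω.2 r) (fun ω => ∑ r, ω.1 r * w ω.2 r)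
      ((Measure.pi fun _ : Fin m => gaussianReal 0 s).prod P) := by
  have ha' : ∀ r, Measurable fun ω => a ω r := fun r => (measurable_pi_apply r).comp ha
  have hw' : ∀ r, Measurable fun ω => w ω r := fun r => (measurable_pi_apply r).comp hw
  have hm1 : Measurable fun ω : (Fin m → ℝ) × Ω' => ∑ r, ω.1 r * a ω.2 r :=
    Finset.measurable_sum _ fun r _ => ((measurable_pi_apply r).comp measurable_fst).mul ((ha' r).comp measurable_snd)
  have hm2 : Measurable fun ω : (Fin m → ℝ) × Ω' => ∑ r, ω.1 r * w ω.2 r :=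
    Finset.measurable_sum _ fun r _ => ((measurable_pi_apply r).comp measurable_fst).mul ((hw' r).comp measurable_snd)
  rw [indepFun_iff_map_prod_eq_prod_map_map hm1.aemeasurable hm2.aemeasurable]
  have i1 := Measure.isProbabilityMeasure_map (μ := (Measure.pi fun _ : Fin m => gaussianReal 0 s).prod P) hm1.aemeasurable
  have i2 := Measure.isProbabilityMeasure_map (μ := (Measure.pi fun _ : Fin m => gaussianReal 0 s).prod P) hm2.aemeasurable
  have i3 := Measure.isProbabilityMeasure_map (μ := (Measure.pi fun _ : Fin m => gaussianReal 0 s).prod P) (hm1.prodMk hm2).aemeasurable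
  apply ext2
  intro α β
  rw [integral_map (hm1.prodMk hm2).aemeasurable (by fun_prop)]
  have e : ∀ p : ℝ×ℝ, Complex.exp (((α*p.1+β*p.2:ℝ):ℂ) * Complex.I)
      = Complex.exp (((α*p.1:ℝ):ℂ) * Complex.I) * Complex.exp (((β*p.2:ℝ):ℂ) * Complex.I) := by
    intro p; rw [← Complex.exp_add]; congr 1; push_cast; ring
  simp_rw [e]
  have h := integral_prod_mul (μ := ((Measure.pi fun _ : Fin m => gaussianReal 0 s).prod P).map (fun ω => ∑ r, ω.1 r * a ω.2 r))
    (ν := ((Measure.pi fun _ : Fin m => gaussianReal 0 s).prod P).map (fun ω => ∑ r, ω.1 r * w ω.2 r))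
    (fun x : ℝ => Complex.exp (((α*x:ℝ):ℂ) * Complex.I)) (fun x : ℝ => Complex.exp (((β*x:ℝ):ℂ) * Complex.I))
  rw [h, integral_map hm1.aemeasurable (by fun_prop), integral_map hm2.aemeasurable (by fun_prop)]
  have h1 := gi_cf P s a w ha hw k2 hk haw α β
  have h2 := gi_cf P s a w ha hw k2 hk haw α 0
  have h3 := gi_cf P s a w ha hw k2 hk haw 0 β
  have z1 : ∀ x : ℝ, ((0:ℝ) * x) = 0 := zero_mul
  simp only [z1, add_zero, zero_add] at h2 h3
  rw [h2, h3]
  rw [h1]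
  simp
end GI

lemma exp_le_quad (z : ℝ) : Real.exp z ≤ 1 + z + z^2 * Real.exp |z| := by
  have h1 : 1 ≤ Real.exp |z| := Real.one_le_exp (abs_nonneg z)
  rcases le_or_gt |z| 1 with h | h
  · have := (abs_le.1 (Real.abs_exp_sub_one_sub_id_le h)).2
    nlinarith [sq_nonneg z]
  · rcases le_or_gt 0 z with hz | hz
    · rw [abs_of_nonneg hz] at *
      have : 1 ≤ z^2 := by nlinarith
      nlinarith [Real.exp_pos z]
    · rw [abs_of_neg hz] at *
      have : Real.exp z ≤ 1 := Real.exp_le_one_iff.2 hz.le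
      nlinarith [sq_nonneg z]

lemma markov_exp {Ω : Type*} [MeasurableSpace Ω] (μ : Measure Ω) [IsProbabilityMeasure μ] (X : Ω → ℝ)
    (M T : ℝ) (h1 : Integrable (fun ω => Real.exp (X ω)) μ) (h2 : ∫ ω, Real.exp (X ω) ∂μ ≤ M) :
    μ.real {ω | T ≤ X ω} ≤ M * Real.exp (-T) := by
  have := measure_ge_le_exp_mul_mgf (μ := μ) (X := X) (t := 1) T zero_le_one (by simpa using h1)
  refine this.trans ?_
  simp only [mgf, one_mul, neg_mul]
  rw [mul_comm]
  gcongr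

lemma markov_abs {Ω : Type*} [MeasurableSpace Ω] (μ : Measure Ω) [IsProbabilityMeasure μ] (X : Ω → ℝ)
    (M T : ℝ) (h : ∀ s : ℝ, s^2 = 1 → Integrable (fun ω => Real.exp (s * X ω)) μ ∧ ∫ ω, Real.exp (s * X ω) ∂μ ≤ M) :
    μ.real {ω | T ≤ |X ω|} ≤ 2 * M * Real.exp (-T) := by
  have a1 := markov_exp μ (fun ω => 1 * X ω) M T (h 1 (by norm_num)).1 (h 1 (by norm_num)).2
  have a2 := markov_exp μ (fun ω => -1 * X ω) M T (h (-1) (by norm_num)).1 (h (-1) (by norm_num)).2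
  have hsub : {ω | T ≤ |X ω|} ⊆ {ω | T ≤ 1 * X ω} ∪ {ω | T ≤ -1 * X ω} := by
    intro ω hω
    simp only [Set.mem_ofPred_eq, Set.mem_union, one_mul, neg_mul] at *
    exact le_abs.1 hω
  calc _ ≤ _ := measureReal_mono hsub
    _ ≤ _ := measureReal_union_le _ _
    _ ≤ _ := by linarith

lemma mgf_one {S : Type*} [MeasurableSpace S] (P : Measure S) [IsProbabilityMeasure P] (Z : S → ℝ)
    (hZ : Measurable Z) (M : ℝ) (h3 : Integrable (fun s => Real.exp (3*|Z s|)) P)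
    (hM : ∫ s, Real.exp (3*|Z s|) ∂P ≤ M) (h0 : ∫ s, Z s ∂P = 0) (l : ℝ) (hl : |l| ≤ 1) :
    Integrable (fun s => Real.exp (l * Z s)) P ∧ ∫ s, Real.exp (l * Z s) ∂P ≤ Real.exp (l^2*M) := by
  have hz : ∀ z : ℝ, |z| ≤ Real.exp |z| := fun z => by linarith [Real.add_one_le_exp |z|]
  have hlz : ∀ z : ℝ, |l*z| ≤ |z| := fun z => by
    rw [abs_mul]; exact mul_le_of_le_one_left (abs_nonneg z) hl
  have e3 : ∀ z : ℝ, Real.exp (3*|z|) = Real.exp |z|^2 * Real.exp |z| := fun z => by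
    rw [← Real.exp_nat_mul, ← Real.exp_add]; congr 1; push_cast; ring
  have hZi : Integrable Z P := h3.mono' hZ.aestronglyMeasurable (ae_of_all _ fun s => by
    rw [Real.norm_eq_abs]; refine (hz _).trans (Real.exp_le_exp.2 (by linarith [abs_nonneg (Z s)])))
  have hi : Integrable (fun s => Real.exp (l * Z s)) P := h3.mono' (by fun_prop) (ae_of_all _ fun s => by
    rw [Real.norm_eq_abs, Real.abs_exp]
    apply Real.exp_le_exp.2
    linarith [le_abs_self (l*Z s), hlz (Z s), abs_nonneg (Z s)])
  refine ⟨hi, ?_⟩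
  have hpt : ∀ s, Real.exp (l * Z s) ≤ (1 + l * Z s) + l^2 * Real.exp (3*|Z s|) := by
    intro s
    refine (exp_le_quad _).trans ?_
    rw [e3, mul_pow]
    have h1 : Real.exp |l * Z s| ≤ Real.exp |Z s| := Real.exp_le_exp.2 (hlz _)
    have h2 : (Z s)^2 ≤ Real.exp |Z s|^2 := by
      rw [← sq_abs]; exact pow_le_pow_left₀ (abs_nonneg _) (hz _) 2
    have : l^2 * Z s^2 * Real.exp |l * Z s| ≤ l^2 * (Real.exp |Z s|^2) * Real.exp |Z s| := by gcongr
    linarith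
  have i1 : Integrable (fun s => 1 + l * Z s) P := (integrable_const _).add (hZi.const_mul l)
  calc _ ≤ ∫ s, ((1 + l * Z s) + l^2 * Real.exp (3*|Z s|)) ∂P :=
        integral_mono hi (i1.add (h3.const_mul _)) hpt
    _ = 1 + l^2 * ∫ s, Real.exp (3*|Z s|) ∂P := by
        rw [integral_add i1 (h3.const_mul _), integral_add (integrable_const _) (hZi.const_mul l),
          integral_const_mul, integral_const_mul, h0]
        simp
    _ ≤ 1 + l^2 * M := by gcongr
    _ ≤ _ := by linarith [Real.add_one_le_exp (l^2*M)]

lemma mgf_sum {S : Type*} [MeasurableSpace S] (P : Measure S) [IsProbabilityMeasure P] (Z : S → ℝ)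
    (hZ : Measurable Z) (M : ℝ) (h3 : Integrable (fun s => Real.exp (3*|Z s|)) P)
    (hM : ∫ s, Real.exp (3*|Z s|) ∂P ≤ M) (h0 : ∫ s, Z s ∂P = 0) (m : ℕ) (l : ℝ) (hl : |l| ≤ 1) :
    Integrable (fun s : Fin m → S => Real.exp (l * ∑ r, Z (s r))) (Measure.pi fun _ => P) ∧
    ∫ s : Fin m → S, Real.exp (l * ∑ r, Z (s r)) ∂(Measure.pi fun _ => P) ≤ Real.exp (m*(l^2*M)) := by
  obtain ⟨hi, hb⟩ := mgf_one P Z hZ M h3 hM h0 l hl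
  have e : (fun s : Fin m → S => Real.exp (l * ∑ r, Z (s r))) = fun s => ∏ r, Real.exp (l * Z (s r)) := by
    funext s; rw [Finset.mul_sum, Real.exp_sum]
  rw [e]
  refine ⟨Integrable.fintype_prod (f := fun _ s => Real.exp (l * Z s)) (fun _ => hi), ?_⟩
  rw [integral_fintype_prod_eq_prod (f := fun _ s => Real.exp (l * Z s))]
  simp only [Finset.prod_const, Finset.card_univ, Fintype.card_fin]
  calc _ ≤ Real.exp (l^2*M)^m := pow_le_pow_left₀ (integral_nonneg fun s => (Real.exp_pos _).le) hb m
    _ = _ := by rw [← Real.exp_nat_mul]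

lemma gam_exp3 : Integrable (fun x => Real.exp (3*|x|)) gam ∧ ∫ x, Real.exp (3*|x|) ∂gam ≤ 3*Real.exp 6 := by
  have hpt : ∀ x : ℝ, Real.exp (3*|x|) ≤ Real.exp 6 * Real.exp (7/16*x^2) := by
    intro x
    rw [← Real.exp_add]
    apply Real.exp_le_exp.2
    rw [← sq_abs x]
    nlinarith [sq_nonneg (|x|-24/7)]
  have hi : Integrable (fun x => Real.exp (3*|x|)) gam :=
    (gam_exp_sq.1.const_mul (Real.exp 6)).mono' (by fun_prop) (ae_of_all _ fun x => by
      rw [Real.norm_eq_abs, Real.abs_exp]; exact hpt x)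
  refine ⟨hi, ?_⟩
  calc _ ≤ ∫ x, Real.exp 6 * Real.exp (7/16*x^2) ∂gam := integral_mono hi (gam_exp_sq.1.const_mul _) hpt
    _ = Real.exp 6 * ∫ x, Real.exp (7/16*x^2) ∂gam := integral_const_mul _ _
    _ ≤ _ := by nlinarith [gam_exp_sq.2, Real.exp_pos 6]

lemma gam2_exp3 : Integrable (fun p : ℝ×ℝ => Real.exp (3*(|p.1|+|p.2|))) (gam.prod gam) ∧
    ∫ p : ℝ×ℝ, Real.exp (3*(|p.1|+|p.2|)) ∂(gam.prod gam) ≤ 9*Real.exp 12 := by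
  have e : (fun p : ℝ×ℝ => Real.exp (3*(|p.1|+|p.2|))) = fun p => Real.exp (3*|p.1|) * Real.exp (3*|p.2|) := by
    funext p; rw [← Real.exp_add]; congr 1; ring
  rw [e]
  refine ⟨gam_exp3.1.mul_prod gam_exp3.1, ?_⟩
  rw [integral_prod_mul (fun x => Real.exp (3*|x|)) (fun x => Real.exp (3*|x|))]
  have h0 : 0 ≤ ∫ x, Real.exp (3*|x|) ∂gam := integral_nonneg fun s => (Real.exp_pos _).le
  calc _ ≤ (3*Real.exp 6)*(3*Real.exp 6) := by gcongr <;> exact gam_exp3.2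
    _ = 9 * (Real.exp 6 * Real.exp 6) := by ring
    _ = _ := by rw [← Real.exp_add]; norm_num

lemma gam2_sq : Integrable (fun p : ℝ×ℝ => Real.exp (1/4*(p.1^2+p.2^2))) (gam.prod gam) ∧
    ∫ p : ℝ×ℝ, Real.exp (1/4*(p.1^2+p.2^2)) ∂(gam.prod gam) ≤ 9 := by
  have hpt : ∀ p : ℝ×ℝ, Real.exp (1/4*(p.1^2+p.2^2)) ≤ Real.exp (7/16*p.1^2) * Real.exp (7/16*p.2^2) := by
    intro p; rw [← Real.exp_add]; apply Real.exp_le_exp.2; nlinarith [sq_nonneg p.1, sq_nonneg p.2]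
  have hj := gam_exp_sq.1.mul_prod gam_exp_sq.1
  have hi : Integrable (fun p : ℝ×ℝ => Real.exp (1/4*(p.1^2+p.2^2))) (gam.prod gam) :=
    hj.mono' (by fun_prop) (ae_of_all _ fun x => by
      rw [Real.norm_eq_abs, Real.abs_exp]; exact hpt x)
  refine ⟨hi, (integral_mono hi hj hpt).trans ?_⟩
  rw [integral_prod_mul (fun x => Real.exp (7/16*x^2)) (fun x => Real.exp (7/16*x^2))]
  have h0 : 0 ≤ ∫ x, Real.exp (7/16*x^2) ∂gam := integral_nonneg fun s => (Real.exp_pos _).le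
  nlinarith [gam_exp_sq.2]

lemma gam2_abs : Integrable (fun p : ℝ×ℝ => |p.1|+|p.2|) (gam.prod gam) ∧
    ∫ p : ℝ×ℝ, (|p.1|+|p.2|) ∂(gam.prod gam) ≤ 2 := by
  have c1 : Integrable (fun _ : ℝ => (1:ℝ)) gam := integrable_const _
  have j1 := int_id.abs.mul_prod c1
  have j2 := c1.mul_prod int_id.abs
  have e1 := integral_prod_mul (μ := gam) (ν := gam) (fun u => |u|) (fun _ => (1:ℝ))
  have e2 := integral_prod_mul (μ := gam) (ν := gam) (fun _ => (1:ℝ)) (fun u => |u|)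
  have e : (fun p : ℝ×ℝ => |p.1|+|p.2|) = fun p => |p.1| * 1 + 1 * |p.2| := by funext p; ring
  rw [e]
  refine ⟨j1.add j2, ?_⟩
  rw [integral_add j1 j2, e1, e2]
  have := int_abs_le
  simp only [integral_const, probReal_univ, smul_eq_mul, mul_one, one_mul]
  linarith

/-- law of one neuron's parameters -/
noncomputable def P1 (d : ℕ) (v : NNReal) : Measure ((Fin d → ℝ) × ℝ) :=
  (Measure.pi fun _ : Fin d => gaussianReal 0 v).prod (gaussianReal 0 v)

instance (d : ℕ) (v : NNReal) : IsProbabilityMeasure (P1 d v) := by unfold P1; infer_instance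

lemma P1_law3 {d : ℕ} (v : NNReal) (κ : ℝ) (hκ : v * κ^2 = 1) (p q : Fin d → ℝ)
    (hp : ∑ l, p l^2 = 1) (hq : ∑ l, q l^2 = 1) :
    (P1 d v).map (fun s => ((κ * ∑ l, s.1 l * p l, κ * ∑ l, s.1 l * q l), κ * s.2)) = law3 (∑ l, p l * q l) := by
  have h1 := (lawt_pi v κ hκ p q hp hq).2
  have h2 : (gaussianReal 0 v).map (fun b => κ * b) = gam := by
    rw [gaussianReal_map_const_mul]
    rw [mul_zero]
    congr 1
    apply NNReal.eq
    rw [NNReal.coe_mul, mul_comm]; exact hκ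
  have := Measure.map_prod_map (Measure.pi fun _ : Fin d => gaussianReal 0 v) (gaussianReal 0 v)
    (f := fun w : Fin d → ℝ => (κ * ∑ l, w l * p l, κ * ∑ l, w l * q l)) (g := fun b => κ * b) (by fun_prop) (by fun_prop)
  rw [h1, h2] at this
  rw [law3, this]; rfl

lemma law3_marg (t : ℝ) (ht : |t| ≤ 1) : (law3 t).map (fun p => (p.1.2, p.2)) = gam.prod gam := by
  rw [law3_rep2 t ht, Measure.map_map (by fun_prop) (by fun_prop)]
  have := Measure.map_prod_map (gam.prod gam) gam (f := Prod.fst) (g := id) (by fun_prop) (by fun_prop)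
  rw [Measure.map_id, Measure.map_fst_prod] at this
  simp only [measure_univ, one_smul] at this
  exact this.symm

lemma P1_marg {d : ℕ} (v : NNReal) (κ : ℝ) (hκ : v * κ^2 = 1) (x : Fin d → ℝ) (hx : ∑ l, x l^2 = 1) :
    (P1 d v).map (fun s => (κ * ∑ l, s.1 l * x l, κ * s.2)) = gam.prod gam := by
  have h := P1_law3 v κ hκ x x hx hx
  have ht := (lawt_pi v κ hκ x x hx hx).1
  rw [← law3_marg _ ht, ← h, Measure.map_map (by fun_prop) (by fun_prop)]
  rfl

lemma P1_int {d : ℕ} (v : NNReal) (κ : ℝ) (hκ : v * κ^2 = 1) (x : Fin d → ℝ) (hx : ∑ l, x l^2 = 1)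
    (f : ℝ×ℝ → ℝ) (hf : Measurable f) (M : ℝ)
    (h : Integrable f (gam.prod gam) ∧ ∫ p, f p ∂(gam.prod gam) ≤ M) :
    Integrable (fun s : (Fin d → ℝ)×ℝ => f (κ * ∑ l, s.1 l * x l, κ * s.2)) (P1 d v) ∧
      ∫ s : (Fin d → ℝ)×ℝ, f (κ * ∑ l, s.1 l * x l, κ * s.2) ∂(P1 d v) ≤ M := by
  rw [← P1_marg v κ hκ x hx] at h
  rw [integrable_map_measure hf.aestronglyMeasurable (by fun_prop),
    integral_map (by fun_prop) hf.aestronglyMeasurable] at h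
  exact h

noncomputable def Qm (d m : ℕ) (v : NNReal) : Measure ((Fin m → Fin d → ℝ) × (Fin m → ℝ)) :=
  (Measure.pi fun _ : Fin m => Measure.pi fun _ : Fin d => gaussianReal 0 v).prod
      (Measure.pi fun _ : Fin m => gaussianReal 0 v)

instance (d m : ℕ) (v : NNReal) : IsProbabilityMeasure (Qm d m v) := by unfold Qm; infer_instance

lemma Qm_mp (d m : ℕ) (v : NNReal) : MeasurePreserving
    (fun ω : (Fin m → Fin d → ℝ) × (Fin m → ℝ) => fun r => (ω.1 r, ω.2 r)) (Qm d m v)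
    (Measure.pi fun _ => P1 d v) :=
  (measurePreserving_arrowProdEquivProdArrow (Fin d → ℝ) ℝ (Fin m)
    (fun _ => Measure.pi fun _ : Fin d => gaussianReal 0 v) (fun _ => gaussianReal 0 v)).symm

lemma Qm_eval (d m : ℕ) (v : NNReal) (r : Fin m) : MeasurePreserving
    (fun ω : (Fin m → Fin d → ℝ) × (Fin m → ℝ) => (ω.1 r, ω.2 r)) (Qm d m v) (P1 d v) :=
  (measurePreserving_eval (fun _ : Fin m => P1 d v) r).comp (Qm_mp d m v)

lemma Qm_int {d m : ℕ} (v : NNReal) (r : Fin m) (f : (Fin d → ℝ)×ℝ → ℝ) (hf : Measurable f) (M : ℝ)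
    (h : Integrable f (P1 d v) ∧ ∫ p, f p ∂(P1 d v) ≤ M) :
    Integrable (fun ω : (Fin m → Fin d → ℝ) × (Fin m → ℝ) => f (ω.1 r, ω.2 r)) (Qm d m v) ∧
      ∫ ω : (Fin m → Fin d → ℝ) × (Fin m → ℝ), f (ω.1 r, ω.2 r) ∂(Qm d m v) ≤ M := by
  have hm := Qm_eval d m v r
  rw [← hm.map_eq] at h
  rw [integrable_map_measure hf.aestronglyMeasurable hm.measurable.aemeasurable,
    integral_map hm.measurable.aemeasurable hf.aestronglyMeasurable] at h
  exact h

section tails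
variable {d m : ℕ} (v : NNReal) (κ : ℝ) (hκ : v * κ^2 = 1) (x : Fin d → ℝ) (hx : ∑ l, x l^2 = 1)
include hκ hx

lemma bad3 (r : Fin m) (T : ℝ) : (Qm d m v).real {ω | T ≤ |κ * ∑ l, ω.1 r l * x l| + |κ * ω.2 r|} ≤
    9*Real.exp 12 * Real.exp (-T) := by
  have h : Integrable (fun p : ℝ×ℝ => Real.exp (|p.1|+|p.2|)) (gam.prod gam) ∧
      ∫ p : ℝ×ℝ, Real.exp (|p.1|+|p.2|) ∂(gam.prod gam) ≤ 9*Real.exp 12 := by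
    have hpt : ∀ p : ℝ×ℝ, Real.exp (|p.1|+|p.2|) ≤ Real.exp (3*(|p.1|+|p.2|)) := fun p =>
      Real.exp_le_exp.2 (by nlinarith [abs_nonneg p.1, abs_nonneg p.2])
    have hi : Integrable (fun p : ℝ×ℝ => Real.exp (|p.1|+|p.2|)) (gam.prod gam) :=
      gam2_exp3.1.mono' (by fun_prop) (ae_of_all _ fun p => by
        rw [Real.norm_eq_abs, Real.abs_exp]; exact hpt p)
    exact ⟨hi, (integral_mono hi gam2_exp3.1 hpt).trans gam2_exp3.2⟩
  have h2 := P1_int v κ hκ x hx _ (by fun_prop) _ h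
  have h3 := Qm_int (m := m) v r _ (by fun_prop) _ h2
  exact markov_exp _ _ _ T h3.1 h3.2

noncomputable def Xf (κ : ℝ) (h : ℝ → ℝ → ℝ) (wst x : Fin d → ℝ) (s : (Fin d → ℝ)×ℝ) : ℝ :=
  h (κ * ∑ l, s.1 l * wst l) (κ * s.2) * max (κ * ∑ l, s.1 l * x l + κ * s.2) 0

omit hκ hx in
lemma Xf_meas (h : ℝ → ℝ → ℝ) (hh : Measurable (Function.uncurry h)) (wst x : Fin d → ℝ) : Measurable (Xf κ h wst x) := by
  unfold Xf
  have : Measurable fun s : (Fin d → ℝ)×ℝ => Function.uncurry h (κ * ∑ l, s.1 l * wst l, κ * s.2) :=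
    hh.comp (by fun_prop)
  exact this.mul (by fun_prop)

omit hκ hx in
lemma Xf_le (h : ℝ → ℝ → ℝ) (h1 : ∀ u b, |h u b| ≤ 1) (wst x : Fin d → ℝ) (s : (Fin d → ℝ)×ℝ) :
    |Xf κ h wst x s| ≤ |κ * ∑ l, s.1 l * x l| + |κ * s.2| := by
  unfold Xf
  rw [abs_mul]
  have h3 : |max (κ * ∑ l, s.1 l * x l + κ * s.2) 0| ≤ |κ * ∑ l, s.1 l * x l| + |κ * s.2| := by
    rw [abs_of_nonneg (le_max_right _ _)]
    exact max_le ((le_abs_self _).trans (abs_add_le _ _)) (by positivity)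
  calc _ ≤ 1 * (|κ * ∑ l, s.1 l * x l| + |κ * s.2|) := by gcongr; exact h1 _ _
    _ = _ := one_mul _

lemma Xf_mean (h : ℝ → ℝ → ℝ) (hh : Measurable (Function.uncurry h)) (h1 : ∀ u b, |h u b| ≤ 1)
    (wst : Fin d → ℝ) : Integrable (Xf κ h wst x) (P1 d v) ∧ |∫ s, Xf κ h wst x s ∂(P1 d v)| ≤ 2 := by
  have h2 := P1_int v κ hκ x hx _ (by fun_prop) _ gam2_abs
  have hi := h2.1.mono' (Xf_meas κ h hh wst x).aestronglyMeasurable (ae_of_all _ (Xf_le κ h h1 wst x))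
  refine ⟨hi, abs_integral_le_integral_abs.trans ((integral_mono hi.abs h2.1 (Xf_le κ h h1 wst x)).trans h2.2)⟩

omit hx in
lemma Xf_law3 (h : ℝ → ℝ → ℝ) (hh : Measurable (Function.uncurry h))
    (wst : Fin d → ℝ) (hx : ∑ l, x l^2 = 1) (hw : ∑ l, wst l^2 = 1) :
    ∫ s, Xf κ h wst x s ∂(P1 d v) =
      ∫ p : (ℝ×ℝ)×ℝ, h p.1.1 p.2 * max (p.1.2+p.2) 0 ∂(law3 (∑ l, wst l * x l)) := by
  rw [← P1_law3 v κ hκ wst x hw hx, integral_map (by fun_prop)]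
  · rfl
  · have : Measurable fun p : (ℝ×ℝ)×ℝ => Function.uncurry h (p.1.1, p.2) := hh.comp (by fun_prop)
    exact (this.mul (by fun_prop)).aestronglyMeasurable

lemma bad2 (hm : 1 ≤ m) (h : ℝ → ℝ → ℝ) (hh : Measurable (Function.uncurry h)) (h1 : ∀ u b, |h u b| ≤ 1)
    (wst : Fin d → ℝ) (T : ℝ) :
    (Qm d m v).real {ω | T ≤ |(√m)⁻¹ * ∑ r, (Xf κ h wst x (ω.1 r, ω.2 r) - ∫ s, Xf κ h wst x s ∂(P1 d v))|} ≤
      2 * Real.exp (9*Real.exp 18) * Real.exp (-T) := by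
  obtain ⟨hi, hμ⟩ := Xf_mean v κ hκ x hx h hh h1 wst
  set μ := ∫ s, Xf κ h wst x s ∂(P1 d v) with hμd
  set Z : (Fin d → ℝ)×ℝ → ℝ := fun s => Xf κ h wst x s - μ with hZd
  have hZm : Measurable Z := (Xf_meas κ h hh wst x).sub_const μ
  have hZ0 : ∫ s, Z s ∂(P1 d v) = 0 := by
    rw [hZd, integral_sub hi (integrable_const _)]; simp [hμd]
  have h2 := P1_int v κ hκ x hx _ (by fun_prop) _ gam2_exp3
  have hpt : ∀ s : (Fin d → ℝ)×ℝ, Real.exp (3*|Z s|) ≤ Real.exp 6 * Real.exp (3*(|κ * ∑ l, s.1 l * x l| + |κ * s.2|)) := by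
    intro s
    rw [← Real.exp_add]
    apply Real.exp_le_exp.2
    have := abs_sub (Xf κ h wst x s) μ
    have := Xf_le κ h h1 wst x s
    simp only [hZd]
    linarith
  have h3 : Integrable (fun s => Real.exp (3*|Z s|)) (P1 d v) :=
    (h2.1.const_mul (Real.exp 6)).mono' (by fun_prop) (ae_of_all _ fun s => by
      rw [Real.norm_eq_abs, Real.abs_exp]; exact hpt s)
  have hM : ∫ s, Real.exp (3*|Z s|) ∂(P1 d v) ≤ 9*Real.exp 18 := by
    refine (integral_mono h3 (h2.1.const_mul (Real.exp 6)) hpt).trans ?_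
    rw [integral_const_mul]
    calc _ ≤ Real.exp 6 * (9*Real.exp 12) := by gcongr; exact h2.2
      _ = 9 * (Real.exp 6 * Real.exp 12) := by ring
      _ = _ := by rw [← Real.exp_add]; norm_num
  have hm0 : (1:ℝ) ≤ m := by exact_mod_cast hm
  have hsq : √(m:ℝ)^2 = m := Real.sq_sqrt (by positivity)
  have hs1 : 1 ≤ √(m:ℝ) := Real.one_le_sqrt.2 hm0
  apply markov_abs
  intro s hs
  have hl : |s * (√m)⁻¹| ≤ 1 := by
    rw [abs_mul, abs_of_nonneg (by positivity : 0 ≤ (√(m:ℝ))⁻¹)]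
    have : |s| = 1 := by rw [← sq_eq_sq₀ (abs_nonneg _) zero_le_one, sq_abs, hs, one_pow]
    rw [this, one_mul]; exact inv_le_one_of_one_le₀ hs1
  have hg := mgf_sum (P1 d v) Z hZm _ h3 hM hZ0 m (s * (√m)⁻¹) hl
  have hmp := Qm_mp d m v
  rw [← hmp.map_eq] at hg
  have hf : Measurable fun z : Fin m → (Fin d → ℝ)×ℝ => Real.exp (s * (√m)⁻¹ * ∑ r, Z (z r)) := by fun_prop
  rw [integrable_map_measure hf.aestronglyMeasurable hmp.measurable.aemeasurable,
    integral_map hmp.measurable.aemeasurable hf.aestronglyMeasurable] at hg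
  have e : (m:ℝ) * ((s * (√m)⁻¹)^2*(9*Real.exp 18)) = 9*Real.exp 18 := by
    rw [mul_pow, hs, inv_pow, hsq]; field_simp
  rw [e] at hg
  simp only [Function.comp_def, mul_assoc] at hg ⊢
  exact hg
end tails

lemma mgf_pi {m : ℕ} (s : NNReal) (k : Fin m → ℝ) :
    Integrable (fun w : Fin m → ℝ => Real.exp (∑ l, k l * w l)) (Measure.pi fun _ => gaussianReal 0 s) ∧
    ∫ w : Fin m → ℝ, Real.exp (∑ l, k l * w l) ∂(Measure.pi fun _ => gaussianReal 0 s) =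
      Real.exp (s*(∑ l, k l^2)/2) := by
  have e : (fun w : Fin m → ℝ => Real.exp (∑ l, k l * w l)) = fun w => ∏ l, Real.exp (k l * w l) := by
    funext w; rw [Real.exp_sum]
  rw [e]
  refine ⟨Integrable.fintype_prod (f := fun l w => Real.exp (k l * w)) (fun l => integrable_exp_mul_gaussianReal _), ?_⟩
  rw [integral_fintype_prod_eq_prod (f := fun l w => Real.exp (k l * w))]
  have : ∀ l, ∫ w, Real.exp (k l * w) ∂(gaussianReal 0 s) = Real.exp (s*k l^2/2) := by
    intro l
    have := congrFun (mgf_fun_id_gaussianReal (μ := 0) (v := s)) (k l)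
    simpa [mgf] using this
  simp only [this]
  rw [← Real.exp_sum, Finset.mul_sum, Finset.sum_div]

lemma bad1 {Ω : Type*} [MeasurableSpace Ω] (μ : Measure Ω) [IsProbabilityMeasure μ] (ρ : Ω → ℝ)
    (hρ : Measurable ρ) (v : NNReal) (hmap : μ.map ρ = gaussianReal 0 v) (k : ℝ) (hk : v*k^2 = 1) (T : ℝ) :
    μ.real {ω | T ≤ |k * ρ ω|} ≤ 2 * 2 * Real.exp (-T) := by
  apply markov_abs
  intro s hs
  have h1 : Integrable (fun x => Real.exp ((s*k)*x)) (gaussianReal 0 v) := integrable_exp_mul_gaussianReal _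
  have h2 : ∫ x, Real.exp ((s*k)*x) ∂(gaussianReal 0 v) ≤ 2 := by
    have := congrFun (mgf_fun_id_gaussianReal (μ := 0) (v := v)) (s*k)
    have e : ∫ x, Real.exp ((s*k)*x) ∂(gaussianReal 0 v) = Real.exp (v*(s*k)^2/2) := by simpa [mgf] using this
    rw [e, mul_pow, hs, one_mul, hk]
    have : Real.exp (1/2)^2 = Real.exp 1 := by rw [← Real.exp_nat_mul]; norm_num
    have := Real.exp_one_lt_d9
    nlinarith [Real.exp_pos (1/2)]
  rw [← hmap, integrable_map_measure (by fun_prop) hρ.aemeasurable] at h1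
  rw [← hmap, integral_map hρ.aemeasurable (by fun_prop)] at h2
  simp only [Function.comp_def, mul_assoc] at h1 h2 ⊢
  exact ⟨h1, h2⟩

lemma bad4 {d m : ℕ} (hm : 1 ≤ m) (v s : NNReal) (hv : v * √(m:ℝ)^2 = 1) (k : ℝ) (hk : s*k^2 = 1)
    (x : Fin d → ℝ) (hx : ∑ l, x l^2 = 1) (T : ℝ) :
    ((Measure.pi fun _ : Fin m => gaussianReal 0 s).prod (Qm d m v)).real
      {ω | T ≤ |k/2 * neuronInput ω.1 ω.2.1 ω.2.2 x|} ≤ 2 * 9 * Real.exp (-T) := by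
  have hm0 : (1:ℝ) ≤ m := by exact_mod_cast hm
  have hsq : √(m:ℝ)^2 = m := Real.sq_sqrt (by positivity)
  apply markov_abs
  intro σ hσ
  have hh := P1_int v _ hv x hx _ (by fun_prop) _ gam2_sq
  have hr := fun r : Fin m => Qm_int (m := m) v r _ (by fun_prop) _ hh
  set g : Fin m → (Fin m → Fin d → ℝ) × (Fin m → ℝ) → ℝ := fun r ω =>
    Real.exp (1/4*((√m * ∑ l, ω.1 r l * x l)^2+(√m * ω.2 r)^2)) with hg
  have hpt : ∀ ω : (Fin m → Fin d → ℝ) × (Fin m → ℝ),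
      Real.exp ((∑ r, max ((∑ l, ω.1 r l * x l) + ω.2 r) 0^2)/8) ≤ ∑ r, (m:ℝ)⁻¹ * g r ω := by
    intro ω
    have hj := convexOn_exp.map_sum_le (t := (Finset.univ : Finset (Fin m))) (w := fun _ => (m:ℝ)⁻¹)
      (p := fun r => 1/4*((√m * ∑ l, ω.1 r l * x l)^2+(√m * ω.2 r)^2)) (fun _ _ => by positivity)
      (by simp; field_simp) (fun _ _ => Set.mem_univ _)
    refine le_trans ?_ hj
    apply Real.exp_le_exp.2
    rw [Finset.sum_div]
    apply Finset.sum_le_sum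
    intro r _
    simp only [smul_eq_mul, mul_pow, hsq]
    have : (m:ℝ)⁻¹ * (1/4*(m * (∑ l, ω.1 r l * x l)^2 + m * ω.2 r^2)) = 1/4*((∑ l, ω.1 r l * x l)^2 + ω.2 r^2) := by
      field_simp
    rw [this]
    have h2 : max ((∑ l, ω.1 r l * x l) + ω.2 r) 0^2 ≤ ((∑ l, ω.1 r l * x l) + ω.2 r)^2 := by
      rcases max_choice ((∑ l, ω.1 r l * x l) + ω.2 r) 0 with h | h <;> rw [h]
      simp; positivity
    nlinarith [sq_nonneg ((∑ l, ω.1 r l * x l) - ω.2 r)]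
  have hgi : Integrable (fun ω => ∑ r, (m:ℝ)⁻¹ * g r ω) (Qm d m v) :=
    integrable_finset_sum _ fun r _ => (hr r).1.const_mul _
  have hgb : ∫ ω, ∑ r, (m:ℝ)⁻¹ * g r ω ∂(Qm d m v) ≤ 9 := by
    rw [integral_finsetSum _ fun r _ => (hr r).1.const_mul _]
    calc _ ≤ ∑ r : Fin m, (m:ℝ)⁻¹ * 9 := Finset.sum_le_sum fun r _ => by
          rw [integral_const_mul]; gcongr; exact (hr r).2
      _ = 9 := by simp; field_simp
  have hei : Integrable (fun ω : (Fin m → Fin d → ℝ) × (Fin m → ℝ) => Real.exp ((∑ r, max ((∑ l, ω.1 r l * x l) + ω.2 r) 0^2)/8)) (Qm d m v) :=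
    hgi.mono' (Measurable.aestronglyMeasurable (by fun_prop)) (ae_of_all _ fun ω => by
      rw [Real.norm_eq_abs, Real.abs_exp]; exact hpt ω)
  have heb := (integral_mono hei hgi hpt).trans hgb
  have hform : ∀ (v : Fin m → ℝ) (ω : (Fin m → Fin d → ℝ) × (Fin m → ℝ)),
      σ * (k/2 * neuronInput v ω.1 ω.2 x) = ∑ r, (σ*(k/2)*max ((∑ l, ω.1 r l * x l) + ω.2 r) 0) * v r := by
    intro v ω
    unfold neuronInput
    rw [Finset.mul_sum, Finset.mul_sum]
    exact Finset.sum_congr rfl fun r _ => by ring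
  have hval : ∀ ω : (Fin m → Fin d → ℝ) × (Fin m → ℝ),
      ∫ w : Fin m → ℝ, Real.exp (σ * (k/2 * neuronInput w ω.1 ω.2 x)) ∂(Measure.pi fun _ => gaussianReal 0 s) =
      Real.exp ((∑ r, max ((∑ l, ω.1 r l * x l) + ω.2 r) 0^2)/8) := by
    intro ω
    simp only [hform]
    rw [(mgf_pi s _).2]
    congr 1
    simp only [mul_pow, hσ, ← Finset.mul_sum]
    rw [div_pow]
    linear_combination (∑ r, max ((∑ l, ω.1 r l * x l) + ω.2 r) 0^2)/8 * hk
  have hI : Integrable (fun ω : (Fin m → ℝ) × (Fin m → Fin d → ℝ) × (Fin m → ℝ) =>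
      Real.exp (σ * (k/2 * neuronInput ω.1 ω.2.1 ω.2.2 x))) ((Measure.pi fun _ : Fin m => gaussianReal 0 s).prod (Qm d m v)) := by
    rw [integrable_prod_iff' (Measurable.aestronglyMeasurable (by unfold neuronInput; fun_prop))]
    refine ⟨ae_of_all _ fun ω => ?_, ?_⟩
    · simp only [hform]
      exact (mgf_pi s _).1
    · simp only [Real.norm_eq_abs, Real.abs_exp, hval]
      exact hei
  refine ⟨hI, ?_⟩
  rw [integral_prod_symm _ hI]
  simp only [hval]
  exact heb

noncomputable def hq {d m : ℕ} (κ : ℝ) (h : ℝ → ℝ → ℝ) (wst : Fin d → ℝ)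
    (ω : (Fin m → Fin d → ℝ) × (Fin m → ℝ)) (r : Fin m) : ℝ :=
  h (κ * ∑ l, ω.1 r l * wst l) (κ * ω.2 r)

noncomputable def gq {d m : ℕ} (κ : ℝ) (h : ℝ → ℝ → ℝ) (wst : Fin d → ℝ) (r0 : Fin m)
    (ω : (Fin m → Fin d → ℝ) × (Fin m → ℝ)) : ℝ :=
  √((m:ℝ) - ∑ r ∈ Finset.univ.erase r0, hq κ h wst ω r ^ 2)

noncomputable def aq {d m : ℕ} (k κ : ℝ) (h : ℝ → ℝ → ℝ) (wst : Fin d → ℝ) (r0 : Fin m)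
    (ω : (Fin m → Fin d → ℝ) × (Fin m → ℝ)) (r : Fin m) : ℝ :=
  k * (if r = r0 then gq κ h wst r0 ω else hq κ h wst ω r)

noncomputable def sq' {d m : ℕ} (x : Fin d → ℝ)
    (ω : (Fin m → Fin d → ℝ) × (Fin m → ℝ)) (r : Fin m) : ℝ :=
  max ((∑ l, ω.1 r l * x l) + ω.2 r) 0

lemma hq_meas {d m : ℕ} (κ : ℝ) (h : ℝ → ℝ → ℝ) (hh : Measurable (Function.uncurry h))
    (wst : Fin d → ℝ) (r : Fin m) : Measurable fun ω => hq κ h wst ω r := by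
  have : Measurable fun ω : (Fin m → Fin d → ℝ) × (Fin m → ℝ) =>
      Function.uncurry h (κ * ∑ l, ω.1 r l * wst l, κ * ω.2 r) := hh.comp (by fun_prop)
  exact this

lemma aq_meas {d m : ℕ} (k κ : ℝ) (h : ℝ → ℝ → ℝ) (hh : Measurable (Function.uncurry h))
    (wst : Fin d → ℝ) (r0 : Fin m) : Measurable (aq k κ h wst r0) := by
  refine measurable_pi_lambda _ fun r => ?_
  unfold aq
  have hg : Measurable (gq κ h wst r0) := by
    unfold gq
    exact (measurable_const.sub (Finset.measurable_sum _ fun r _ => (hq_meas κ h hh wst r).pow_const 2)).sqrt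
  split_ifs
  · exact hg.const_mul k
  · exact (hq_meas κ h hh wst r).const_mul k

lemma sq'_meas {d m : ℕ} (x : Fin d → ℝ) : Measurable (sq' (m := m) x) := by
  refine measurable_pi_lambda _ fun r => ?_
  unfold sq'
  fun_prop

lemma hq_sum_le {d m : ℕ} (κ : ℝ) (h : ℝ → ℝ → ℝ) (h1 : ∀ u b, |h u b| ≤ 1)
    (wst : Fin d → ℝ) (r0 : Fin m) (ω : (Fin m → Fin d → ℝ) × (Fin m → ℝ)) :
    ∑ r ∈ Finset.univ.erase r0, hq κ h wst ω r ^ 2 ≤ m := by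
  have h2 : ∀ r, hq κ h wst ω r ^ 2 ≤ 1 := fun r => by
    unfold hq; rw [sq_le_one_iff_abs_le_one]; exact h1 _ _
  calc ∑ r ∈ Finset.univ.erase r0, hq κ h wst ω r ^ 2 ≤ ∑ r : Fin m, hq κ h wst ω r ^ 2 :=
        Finset.sum_le_sum_of_subset_of_nonneg (Finset.erase_subset _ _) fun _ _ _ => sq_nonneg _
    _ ≤ ∑ r : Fin m, (1:ℝ) := Finset.sum_le_sum fun r _ => h2 r
    _ = m := by simp

lemma aq_sq {d m : ℕ} (k κ : ℝ) (h : ℝ → ℝ → ℝ) (h1 : ∀ u b, |h u b| ≤ 1)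
    (wst : Fin d → ℝ) (r0 : Fin m) (ω : (Fin m → Fin d → ℝ) × (Fin m → ℝ)) :
    ∑ r, aq k κ h wst r0 ω r ^ 2 = k^2 * m := by
  rw [← Finset.add_sum_erase _ _ (Finset.mem_univ r0)]
  have e : ∑ r ∈ Finset.univ.erase r0, aq k κ h wst r0 ω r ^ 2 =
      k^2 * ∑ r ∈ Finset.univ.erase r0, hq κ h wst ω r ^ 2 := by
    rw [Finset.mul_sum]
    refine Finset.sum_congr rfl fun r hr => ?_
    simp only [aq, if_neg (Finset.ne_of_mem_erase hr)]
    ring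
  rw [e]
  simp only [aq, if_true, mul_pow]
  rw [gq, Real.sq_sqrt (sub_nonneg.2 (hq_sum_le κ h h1 wst r0 ω))]
  ring

lemma aq_det {d m : ℕ} (hm : 1 ≤ m) (C : ℝ) (hC : 0 < C) (h : ℝ → ℝ → ℝ) (h1 : ∀ u b, |h u b| ≤ 1)
    (wst x : Fin d → ℝ) (r0 : Fin m) (ω : (Fin m → Fin d → ℝ) × (Fin m → ℝ)) (μ T : ℝ)
    (hT2 : |(√m)⁻¹ * ∑ r, (Xf √m h wst x (ω.1 r, ω.2 r) - μ)| ≤ T)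
    (hT3 : |√m * ∑ l, ω.1 r0 l * x l| + |√m * ω.2 r0| ≤ T) :
    |100*C^2 * ∑ r, aq (1/(10*C*√m)) √m h wst r0 ω r * sq' x ω r - 10*C*μ| ≤ 30*C*T/√m := by
  have hm0 : (1:ℝ) ≤ m := by exact_mod_cast hm
  have hu1 : 1 ≤ √(m:ℝ) := Real.one_le_sqrt.2 hm0
  have hsq : √(m:ℝ)^2 = m := Real.sq_sqrt (by positivity)
  set u := √(m:ℝ) with hu
  have hu0 : 0 < u := by linarith
  set g := gq u h wst r0 ω with hg
  have hX : ∀ r, Xf u h wst x (ω.1 r, ω.2 r) = hq u h wst ω r * (u * sq' x ω r) := by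
    intro r
    simp only [Xf, hq, sq']
    rw [mul_max_of_nonneg _ _ hu0.le, mul_add, mul_zero]
  have hsum : ∑ r, aq (1/(10*C*u)) u h wst r0 ω r * sq' x ω r =
      1/(10*C*u) * (∑ r, hq u h wst ω r * sq' x ω r + (g - hq u h wst ω r0) * sq' x ω r0) := by
    rw [← Finset.add_sum_erase _ _ (Finset.mem_univ r0),
      ← Finset.add_sum_erase _ (fun r => hq u h wst ω r * sq' x ω r) (Finset.mem_univ r0)]
    have e : ∑ r ∈ Finset.univ.erase r0, aq (1/(10*C*u)) u h wst r0 ω r * sq' x ω r =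
      1/(10*C*u) * ∑ r ∈ Finset.univ.erase r0, hq u h wst ω r * sq' x ω r := by
      rw [Finset.mul_sum]
      refine Finset.sum_congr rfl fun r hr => ?_
      simp only [aq, if_neg (Finset.ne_of_mem_erase hr)]
      ring
    rw [e]
    simp only [aq, if_true]
    ring
  have hXs : ∑ r, (Xf u h wst x (ω.1 r, ω.2 r) - μ) = u * ∑ r, hq u h wst ω r * sq' x ω r - u^2*μ := by
    rw [Finset.sum_sub_distrib, Finset.mul_sum]
    congr 1
    · exact Finset.sum_congr rfl fun r _ => by rw [hX]; ring
    · simp [hsq]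
  have hgu : g ≤ u := Real.sqrt_le_sqrt (by
    have : 0 ≤ ∑ r ∈ Finset.univ.erase r0, hq u h wst ω r ^ 2 := Finset.sum_nonneg fun _ _ => sq_nonneg _
    linarith)
  have hg0 : 0 ≤ g := Real.sqrt_nonneg _
  have hh0 : |hq u h wst ω r0| ≤ 1 := h1 _ _
  have hgh : |g - hq u h wst ω r0| ≤ 2*u := by
    rw [abs_le] at hh0 ⊢; constructor <;> linarith
  have hs0 : |u * sq' x ω r0| ≤ T := by
    refine le_trans ?_ hT3
    simp only [sq']
    rw [mul_max_of_nonneg _ _ hu0.le, mul_add, mul_zero, abs_of_nonneg (le_max_right _ _)]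
    exact max_le ((le_abs_self _).trans ((abs_add_le _ _).trans le_rfl)) (by positivity)
  have key : 100*C^2 * ∑ r, aq (1/(10*C*u)) u h wst r0 ω r * sq' x ω r - 10*C*μ =
      10*C/u * (u⁻¹ * ∑ r, (Xf u h wst x (ω.1 r, ω.2 r) - μ)) +
      10*C/u^2 * ((g - hq u h wst ω r0) * (u * sq' x ω r0)) := by
    rw [hsum, hXs]
    field_simp
    ring
  rw [key]
  refine (abs_add_le _ _).trans ?_
  have t1 : |10*C/u * (u⁻¹ * ∑ r, (Xf u h wst x (ω.1 r, ω.2 r) - μ))| ≤ 10*C/u*T := by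
    rw [abs_mul, abs_of_pos (show 0 < 10*C/u by positivity)]
    gcongr
  have t2 : |10*C/u^2 * ((g - hq u h wst ω r0) * (u * sq' x ω r0))| ≤ 10*C/u^2*((2*u)*T) := by
    rw [abs_mul, abs_mul (g - _), abs_of_pos (show 0 < 10*C/u^2 by positivity)]
    gcongr
  have : 10*C/u*T + 10*C/u^2*((2*u)*T) = 30*C*T/u := by field_simp; ring
  linarith

/-- Probability of good event from four bad events. -/
lemma good_prob {Ω : Type*} [MeasurableSpace Ω] (μ : Measure Ω) [IsProbabilityMeasure μ]
    (S b1 b2 b3 b4 : Set Ω) (hS : ∀ ω, ω ∉ b1 → ω ∉ b2 → ω ∉ b3 → ω ∉ b4 → ω ∈ S) (δ : ℝ)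
    (hb : μ.real b1 + μ.real b2 + μ.real b3 + μ.real b4 ≤ δ) :
    μ S ≥ ENNReal.ofReal (1 - δ) := by
  have h1 : (Set.univ : Set Ω) ⊆ S ∪ (b1 ∪ b2 ∪ b3 ∪ b4) := by
    intro ω _
    by_contra hc
    simp only [Set.mem_union, not_or] at hc
    exact hc.1 (hS ω hc.2.1.1.1 hc.2.1.1.2 hc.2.1.2 hc.2.2)
  have h2 : (1:ℝ) ≤ μ.real S + μ.real (b1 ∪ b2 ∪ b3 ∪ b4) := by
    rw [← probReal_univ (μ := μ)]
    exact (measureReal_mono h1).trans (measureReal_union_le _ _)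
  have h3 := measureReal_union_le (μ := μ) (b1 ∪ b2 ∪ b3) b4
  have h4 := measureReal_union_le (μ := μ) (b1 ∪ b2) b3
  have h5 := measureReal_union_le (μ := μ) b1 b2
  refine ENNReal.ofReal_le_of_le_toReal ?_
  change 1 - δ ≤ μ.real S
  linarith

lemma snd_real {Ω Ω' : Type*} [MeasurableSpace Ω] [MeasurableSpace Ω'] (μ : Measure Ω) [IsProbabilityMeasure μ]
    (P : Measure Ω') [IsProbabilityMeasure P] (S : Set Ω') (δ : ℝ) (hS : MeasurableSet S) (h : P.real S ≤ δ) :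
    (μ.prod P).real {ω | ω.2 ∈ S} ≤ δ := by
  have := (measurePreserving_snd (μ := μ) (ν := P)).measureReal_preimage hS.nullMeasurableSet
  change (μ.prod P).real (Prod.snd ⁻¹' S) ≤ δ
  rw [this]; exact h

/-- Elementary numerics for the failure probability. -/
lemma num_exp (D l : ℝ) (hD : 0 ≤ D) (hl : 1 ≤ l) :
    D * Real.exp (-((1+D)*l^2)) ≤ Real.exp (-1 * l^2) := by
  have e : -((1+D)*l^2) = -1*l^2 + -(D*l^2) := by ring
  rw [e, Real.exp_add]
  have h1 : D * Real.exp (-(D*l^2)) ≤ 1 := by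
    rw [Real.exp_neg, ← div_eq_mul_inv, div_le_one (Real.exp_pos _)]
    have := Real.add_one_le_exp (D*l^2)
    nlinarith [mul_le_mul_of_nonneg_left (one_le_pow₀ hl (n := 2)) hD]
  calc D * (Real.exp (-1*l^2) * Real.exp (-(D*l^2))) = Real.exp (-1*l^2) * (D*Real.exp (-(D*l^2))) := by ring
    _ ≤ Real.exp (-1*l^2) * 1 := by gcongr
    _ = _ := mul_one _

lemma num_K (K1 l : ℝ) (hl : 1 ≤ l) :
    7*(K1*l^2)^2 ≤ (7*K1^2+4) * l^(7*K1^2+4 : ℝ) := by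
  have h1 : l^4 ≤ l^(7*K1^2+4 : ℝ) := by
    rw [← Real.rpow_natCast]
    exact Real.rpow_le_rpow_of_exponent_le hl (by push_cast; nlinarith [sq_nonneg K1])
  have h0 : 0 ≤ l^4 := by positivity
  calc 7*(K1*l^2)^2 = 7*K1^2*l^4 := by ring
    _ ≤ (7*K1^2+4)*l^4 := by nlinarith
    _ ≤ _ := by gcongr

lemma sum_proj {m : ℕ} (p a s : Fin m → ℝ) (q : ℝ) :
    ∑ r, p r * (s r - q * a r) = ∑ r, p r * s r - q * ∑ r, p r * a r := by
  rw [Finset.mul_sum, ← Finset.sum_sub_distrib]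
  exact Finset.sum_congr rfl fun r _ => by ring

set_option maxHeartbeats 1600000 in
/-- **Information out of randomness.** There are absolute constants `c', K > 0` such that for a
power series `φ` with `C = 𝔠_ε(φ,1) < ∞`, a unit vector `w*`, and `ε ∈ (0, 1/𝔠_s(φ,1))`, the
random first-layer output `n₁(x)` decomposes as `ρ·φ_ε(x) + B(x,·) + R(x,·)` where: `ρ` is
independent of `B(x,·)` for every fixed `x`; `ρ ∼ N(0, 1/(100 C² m₂))`; `φ_ε` approximates
`φ(⟨w*,·⟩)` up to `ε` on unit inputs with `x_d = 1/2`; and with high probability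
`|R(x,·)| ≤ Õ(1/√(m₁m₂))` and `|B(x,·)| ≤ Õ(1/√m₂)`. -/
theorem information_out_of_randomness :
    ∃ c' K : ℝ, 0 < c' ∧ 0 < K ∧
      ∀ (d m₁ m₂ : ℕ) (hd : 0 < d), 2 ≤ m₁ → 2 ≤ m₂ →
      ∀ (co : ℕ → ℝ), Summable (csSummand co 1) →
      ∀ wstar : Fin d → ℝ, (∑ l, (wstar l) ^ 2) = 1 →
      ∀ ε : ℝ, 0 < ε → ε < 1 / csOf co 1 → Summable (ceSummand co 1 ε) →
      ∃ (ρ : (Fin m₁ → ℝ) × (Fin m₁ → Fin d → ℝ) × (Fin m₁ → ℝ) → ℝ)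
        (B R : (Fin d → ℝ) → (Fin m₁ → ℝ) × (Fin m₁ → Fin d → ℝ) × (Fin m₁ → ℝ) → ℝ)
        (φε : (Fin d → ℝ) → ℝ),
        -- (i) exact decomposition, for every input and every realization
        (∀ (x : Fin d → ℝ) ω, neuronInput ω.1 ω.2.1 ω.2.2 x
          = ρ ω * φε x + B x ω + R x ω) ∧
        -- (ii) for every fixed x, ρ is independent of B(x,·)
        (∀ x : Fin d → ℝ, IndepFun ρ (B x) (initRand d m₁ m₂)) ∧
        -- (iii) ρ ∼ N(0, 1/(100 C² m₂))
        ((initRand d m₁ m₂).map ρ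
          = gaussianReal 0 (Real.toNNReal (1 / (100 * (ceOf co 1 ε) ^ 2 * m₂)))) ∧
        -- (iv) φ_ε approximates φ(⟨w*,·⟩)
        (∀ x : Fin d → ℝ, (∑ l, (x l) ^ 2) = 1 →
          x ⟨d - 1, Nat.sub_lt hd one_pos⟩ = 1 / 2 →
          |φε x - psVal co (∑ l, wstar l * x l)| ≤ ε) ∧
        -- (v) high-probability bounds on R and B
        (∀ x : Fin d → ℝ, (∑ l, (x l) ^ 2) = 1 →
          x ⟨d - 1, Nat.sub_lt hd one_pos⟩ = 1 / 2 →
          initRand d m₁ m₂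
              {ω | |R x ω| ≤ K * (Real.log (m₁ * m₂ : ℕ)) ^ K
                  / Real.sqrt ((m₁ : ℝ) * m₂)}
            ≥ ENNReal.ofReal (1 - Real.exp (-c' * (Real.log (m₁ * m₂ : ℕ)) ^ 2)) ∧
          initRand d m₁ m₂
              {ω | |B x ω| ≤ K * (Real.log (m₁ * m₂ : ℕ)) ^ K / Real.sqrt (m₂ : ℝ)}
            ≥ ENNReal.ofReal (1 - Real.exp (-c' * (Real.log (m₁ * m₂ : ℕ)) ^ 2))) := by
  set D : ℝ := 22 + 2 * Real.exp (9*Real.exp 18) + 9*Real.exp 12 with hD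
  have hD0 : 0 ≤ D := by positivity
  refine ⟨1, 7*(1+D)^2+4, one_pos, by positivity, ?_⟩
  intro d m₁ m₂ hd hm1 hm2 co hcs wst hw ε he he2 hce
  obtain ⟨-, -, hne⟩ := cs_facts co hcs ε he he2
  have hC := ce_pos co ε hce hne
  obtain ⟨h, hh, h1, happ⟩ := exists_h co hcs ε he he2 hce
  set C := ceOf co 1 ε with hCd
  have hm1' : 1 ≤ m₁ := by omega
  have hm10 : (1:ℝ) ≤ m₁ := by exact_mod_cast hm1'
  have hm20 : (1:ℝ) ≤ m₂ := by exact_mod_cast (show 1 ≤ m₂ by omega)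
  set u := √(m₁:ℝ) with hu
  set w := √(m₂:ℝ) with hwd
  have hu1 : 1 ≤ u := Real.one_le_sqrt.2 hm10
  have hw1 : 1 ≤ w := Real.one_le_sqrt.2 hm20
  have husq : u^2 = m₁ := Real.sq_sqrt (by positivity)
  have hwsq : w^2 = m₂ := Real.sq_sqrt (by positivity)
  set v := Real.toNNReal (1/(m₁:ℝ)) with hv
  set s := Real.toNNReal (1/(m₂:ℝ)) with hs
  have hvc : (v:ℝ) = 1/m₁ := Real.coe_toNNReal _ (by positivity)
  have hsc : (s:ℝ) = 1/m₂ := Real.coe_toNNReal _ (by positivity)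
  have hκ : (v:ℝ) * u^2 = 1 := by rw [hvc, husq]; field_simp
  have hsw : (s:ℝ) * w^2 = 1 := by rw [hsc, hwsq]; field_simp
  set r0 : Fin m₁ := ⟨0, by omega⟩ with hr0
  set a := aq (1/(10*C*u)) u h wst r0 with ha
  have ham : Measurable a := aq_meas _ _ h hh wst r0
  have hk : ∀ ω, ∑ r, a ω r^2 = 1/(100*C^2) := by
    intro ω
    rw [ha, aq_sq _ _ h h1, ← husq]
    field_simp
    norm_num
  set ip : (Fin d → ℝ) → (Fin m₁ → Fin d → ℝ) × (Fin m₁ → ℝ) → ℝ := fun x ω => ∑ r, a ω r * sq' x ω r with hip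
  have hipm : ∀ x, Measurable (ip x) := fun x => Finset.measurable_sum _ fun r _ =>
    ((measurable_pi_apply r).comp ham).mul ((measurable_pi_apply r).comp (sq'_meas x))
  set ρ : (Fin m₁ → ℝ) × (Fin m₁ → Fin d → ℝ) × (Fin m₁ → ℝ) → ℝ := fun ω => ∑ r, ω.1 r * a ω.2 r with hρ
  set φe : (Fin d → ℝ) → ℝ := fun x => 10*C*∫ p, Xf u h wst x p ∂(P1 d v) with hφe
  set B : (Fin d → ℝ) → (Fin m₁ → ℝ) × (Fin m₁ → Fin d → ℝ) × (Fin m₁ → ℝ) → ℝ := fun x ω =>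
    ∑ r, ω.1 r * (sq' x ω.2 r - 100*C^2*ip x ω.2 * a ω.2 r) with hB
  set R : (Fin d → ℝ) → (Fin m₁ → ℝ) × (Fin m₁ → Fin d → ℝ) × (Fin m₁ → ℝ) → ℝ := fun x ω =>
    ρ ω * (100*C^2*ip x ω.2 - φe x) with hR
  have hinit : initRand d m₁ m₂ = (Measure.pi fun _ : Fin m₁ => gaussianReal 0 s).prod (Qm d m₁ v) := rfl
  have hρm : Measurable ρ := Finset.measurable_sum _ fun r _ =>
    ((measurable_pi_apply r).comp measurable_fst).mul (((measurable_pi_apply r).comp ham).comp measurable_snd)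
  have hdec : ∀ x ω, neuronInput ω.1 ω.2.1 ω.2.2 x = ρ ω * φe x + B x ω + R x ω := by
    intro x ω
    have e1 : B x ω = neuronInput ω.1 ω.2.1 ω.2.2 x - 100*C^2*ip x ω.2 * ρ ω := by
      exact sum_proj ω.1 (a ω.2) (sq' x ω.2) (100*C^2*ip x ω.2)
    rw [e1]; simp only [hR]; ring
  have hmap : (initRand d m₁ m₂).map ρ = gaussianReal 0 (Real.toNNReal (1 / (100 * C ^ 2 * m₂))) := by
    rw [hinit]
    refine gi_map (Qm d m₁ v) s a ham _ hk _ ?_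
    rw [Real.coe_toNNReal _ (by positivity), hsc]
    field_simp
  refine ⟨ρ, B, R, φe, hdec, ?_, hmap, ?_, ?_⟩
  · intro x
    rw [hinit]
    refine gi_indep (Qm d m₁ v) s a (fun ω r => sq' x ω r - 100*C^2*ip x ω * a ω r) ham ?_ _ hk ?_
    · refine measurable_pi_lambda _ fun r => ?_
      exact ((measurable_pi_apply r).comp (sq'_meas x)).sub
        (((hipm x).const_mul _).mul ((measurable_pi_apply r).comp ham))
    · intro ω
      have e : ∑ r, a ω r * (sq' x ω r - 100*C^2*ip x ω * a ω r) =
          ip x ω - 100*C^2*ip x ω * ∑ r, a ω r^2 := by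
        rw [sum_proj (a ω) (a ω) (sq' x ω) (100*C^2*ip x ω)]
        simp only [hip, sq]
      rw [e, hk]
      field_simp
      ring
  · intro x hx _
    simp only [hφe]
    rw [Xf_law3 v u hκ x h hh wst hx hw]
    exact happ _ (lawt_pi v u hκ wst x hw hx).1
  · intro x hx _
    set l := Real.log (m₁ * m₂ : ℕ) with hl
    have hl1 : 1 ≤ l := by
      rw [hl, Real.le_log_iff_exp_le (by positivity)]
      have : (4:ℝ) ≤ ((m₁ * m₂ : ℕ):ℝ) := by exact_mod_cast (Nat.mul_le_mul hm1 hm2)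
      linarith [Real.exp_one_lt_d9]
    set T := (1+D)*l^2 with hT
    have hT1 : 1 ≤ T := by
      have : 1 ≤ l^2 := one_le_pow₀ hl1
      rw [hT]; nlinarith only [this, hD0]
    have hKT : 7*T^2 ≤ (7*(1+D)^2+4) * l^(7*(1+D)^2+4 : ℝ) := num_K (1+D) l hl1
    set KK := (7*(1+D)^2+4) * l^(7*(1+D)^2+4 : ℝ) with hKK
    have hTT : T ≤ T^2 := by nlinarith only [hT1]
    have h3K : 3*T^2 ≤ KK := by linarith only [hKT, sq_nonneg T]
    have h7K : 2*T+2*T+3*T^2 ≤ KK := by linarith only [hKT, hTT]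
    set μ0 := ∫ p, Xf u h wst x p ∂(P1 d v) with hμ0
    have hμ2 : |μ0| ≤ 2 := (Xf_mean v u hκ x hx h hh h1 wst).2
    set S2 : Set ((Fin m₁ → Fin d → ℝ) × (Fin m₁ → ℝ)) :=
      {ω | T ≤ |(√m₁)⁻¹ * ∑ r, (Xf u h wst x (ω.1 r, ω.2 r) - μ0)|} with hS2
    set S3 : Set ((Fin m₁ → Fin d → ℝ) × (Fin m₁ → ℝ)) :=
      {ω | T ≤ |u * ∑ l, ω.1 r0 l * x l| + |u * ω.2 r0|} with hS3
    have hS2m : MeasurableSet S2 := by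
      refine measurableSet_le measurable_const ?_
      have : Measurable fun ω : (Fin m₁ → Fin d → ℝ) × (Fin m₁ → ℝ) =>
          ∑ r, (Xf u h wst x (ω.1 r, ω.2 r) - μ0) := Finset.measurable_sum _ fun r _ =>
        ((Xf_meas u h hh wst x).comp (by fun_prop)).sub measurable_const
      exact (this.const_mul _).abs
    have hS3m : MeasurableSet S3 := measurableSet_le measurable_const (by fun_prop)
    have b1 := bad1 ((Measure.pi fun _ : Fin m₁ => gaussianReal 0 s).prod (Qm d m₁ v)) ρ hρm _ hmap (10*C*w)
      (by rw [Real.coe_toNNReal _ (by positivity), mul_pow, hwsq]; field_simp; norm_num) T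
    have b2 := snd_real (Measure.pi fun _ : Fin m₁ => gaussianReal 0 s) (Qm d m₁ v) S2 _ hS2m
      (bad2 v u hκ x hx hm1' h hh h1 wst T)
    have b3 := snd_real (Measure.pi fun _ : Fin m₁ => gaussianReal 0 s) (Qm d m₁ v) S3 _ hS3m
      (bad3 v u hκ x hx r0 T)
    have b4 := bad4 (d := d) hm1' v s hκ w hsw x hx T
    have hfail := num_exp D l hD0 hl1
    have htot := hfail
    rw [← hT, hD] at htot
    have main : ∀ ω, ω ∉ {ω | T ≤ |10*C*w * ρ ω|} → ω ∉ {ω : (Fin m₁ → ℝ) × (Fin m₁ → Fin d → ℝ) × (Fin m₁ → ℝ) | ω.2 ∈ S2} →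
        ω ∉ {ω : (Fin m₁ → ℝ) × (Fin m₁ → Fin d → ℝ) × (Fin m₁ → ℝ) | ω.2 ∈ S3} →
        ω ∉ {ω : (Fin m₁ → ℝ) × (Fin m₁ → Fin d → ℝ) × (Fin m₁ → ℝ) | T ≤ |w/2 * neuronInput ω.1 ω.2.1 ω.2.2 x|} →
        |R x ω| ≤ KK / √((m₁:ℝ)*m₂) ∧ |B x ω| ≤ KK / w := by
      intro ω g1 g2 g3 g4
      simp only [Set.mem_ofPred_eq, not_le, hS2, hS3] at g1 g2 g3 g4
      have hdet := aq_det hm1' C hC h h1 wst x r0 ω.2 μ0 T g2.le g3.le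
      have hρb : |ρ ω| ≤ T/(10*C*w) := by
        rw [le_div_iff₀ (by positivity)]
        rw [abs_mul, abs_of_pos (show 0 < 10*C*w by positivity)] at g1
        linarith
      have hnb : |neuronInput ω.1 ω.2.1 ω.2.2 x| ≤ 2*T/w := by
        rw [le_div_iff₀ (by positivity)]
        rw [abs_mul, abs_of_pos (show 0 < w/2 by positivity)] at g4
        linarith
      have hRb : |R x ω| ≤ 3*T^2/(u*w) := by
        simp only [hR]
        rw [abs_mul]
        calc |ρ ω| * |100*C^2*ip x ω.2 - φe x| ≤ T/(10*C*w) * (30*C*T/u) :=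
              mul_le_mul hρb hdet (abs_nonneg _) (by positivity)
          _ = _ := by field_simp; norm_num
      have hφb : |φe x| ≤ 20*C := by
        simp only [hφe]
        rw [abs_mul, abs_of_pos (show 0 < 10*C by positivity)]
        calc 10*C*|μ0| ≤ 10*C*2 := by gcongr
          _ = 20*C := by ring
      have hpb : |ρ ω * φe x| ≤ 2*T/w := by
        rw [abs_mul]
        calc |ρ ω| * |φe x| ≤ T/(10*C*w) * (20*C) := mul_le_mul hρb hφb (abs_nonneg _) (by positivity)
          _ = _ := by field_simp; norm_num
      constructor
      · rw [Real.sqrt_mul (by positivity)]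
        refine hRb.trans ?_
        gcongr
      · have e : B x ω = neuronInput ω.1 ω.2.1 ω.2.2 x - ρ ω * φe x - R x ω := by rw [hdec x ω]; ring
        have hR2 : |R x ω| ≤ 3*T^2/w := hRb.trans (by
          gcongr
          exact le_mul_of_one_le_left (by positivity) hu1)
        rw [e]
        calc _ ≤ |neuronInput ω.1 ω.2.1 ω.2.2 x| + |ρ ω * φe x| + |R x ω| :=
              (abs_sub _ _).trans (by gcongr; exact abs_sub _ _)
          _ ≤ 2*T/w + 2*T/w + 3*T^2/w := by gcongr
          _ = (2*T+2*T+3*T^2)/w := by ring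
          _ ≤ KK/w := by
            gcongr
    rw [hinit]
    have hsum : _ + _ + _ + _ ≤ Real.exp (-1 * l^2) := (add_le_add (add_le_add (add_le_add b1 b2) b3) b4).trans (by
      have := Real.exp_pos (-T)
      linarith)
    exact ⟨good_prob _ _ _ _ _ _ (fun ω g1 g2 g3 g4 => (main ω g1 g2 g3 g4).1) _ hsum,
      good_prob _ _ _ _ _ _ (fun ω g1 g2 g3 g4 => (main ω g1 g2 g3 g4).2) _ hsum⟩
end

section
/- Negative curvature from expected decrease. Let f : ℝ^d → ℝ be twice continuously differentiable with B-Lipschitz Hessian, i.e. ‖∇²f(u) − ∇²f(v)‖_op ≤ B·‖u − v‖₂ for all u,v. Let ε > 0, let η ∈ (0, ε/B], let x ∈ ℝ^d be fixed, and suppose x₂ is a random vector in ℝ^d with E[x₂] = 0 and ‖x₂‖₂ = 1 almost surely, satisfying E[ f(x + η·x₂) ] ≤ f(x) − ε·η². Then λ_min(∇²f(x)) ≤ −ε; in particular there exists a unit vector u ∈ ℝ^d with ⟨u, ∇²f(x)·u⟩ ≤ −ε. -/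
open MeasureTheory

/-- Strict lower Taylor bound in one direction. -/
lemma taylor_strict_aux {E : Type*} [NormedAddCommGroup E] [NormedSpace ℝ E]
    (f : E → ℝ) (hf : ContDiff ℝ 2 f) (x u : E) (ε η : ℝ) (hη : 0 < η)
    (h : ∀ t ∈ Set.Ioo 0 η, -(2 * ε) < iteratedFDeriv ℝ 2 f (x + t • u) ![u, u]) :
    0 < f (x + η • u) - f x - η * fderiv ℝ f x u + ε * η ^ 2 := by
  have hl : ∀ t : ℝ, HasDerivAt (fun t : ℝ => x + t • u) u t := by
    intro t
    simpa using ((hasDerivAt_id t).smul_const u).const_add x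
  have hd1 : Differentiable ℝ f := hf.differentiable (by norm_num)
  have hd2 : Differentiable ℝ (fderiv ℝ f) :=
    (hf.fderiv_right (m := 1) (by norm_num)).differentiable (by norm_num)
  have h1 : ∀ t : ℝ, HasDerivAt (fun t : ℝ => f (x + t • u)) (fderiv ℝ f (x + t • u) u) t :=
    fun t => (hd1 _).hasFDerivAt.comp_hasDerivAt t (hl t)
  have h2 : ∀ t : ℝ, HasDerivAt (fun t : ℝ => fderiv ℝ f (x + t • u) u)
      (fderiv ℝ (fderiv ℝ f) (x + t • u) u u) t := by
    intro t
    have := (hd2 (x + t • u)).hasFDerivAt.comp_hasDerivAt t (hl t)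
    simpa using this.clm_apply (hasDerivAt_const t u)
  have h3 : ∀ t : ℝ, HasDerivAt
      (fun t : ℝ => fderiv ℝ f (x + t • u) u - fderiv ℝ f x u + 2 * ε * t)
      (fderiv ℝ (fderiv ℝ f) (x + t • u) u u + 2 * ε) t := by
    intro t
    simpa using ((h2 t).sub_const (fderiv ℝ f x u)).fun_add ((hasDerivAt_id t).const_mul (2 * ε))
  have h4 : ∀ t : ℝ, HasDerivAt
      (fun t : ℝ => f (x + t • u) - f x - t * fderiv ℝ f x u + ε * t ^ 2)
      (fderiv ℝ f (x + t • u) u - fderiv ℝ f x u + 2 * ε * t) t := by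
    intro t
    refine ((((h1 t).sub_const (f x)).fun_sub
      ((hasDerivAt_id' t).mul_const (fderiv ℝ f x u))).fun_add
      ((hasDerivAt_pow 2 t).const_mul ε)).congr_deriv ?_
    simp
    ring
  have m1 : StrictMonoOn
      (fun t : ℝ => fderiv ℝ f (x + t • u) u - fderiv ℝ f x u + 2 * ε * t) (Set.Icc 0 η) := by
    apply strictMonoOn_of_deriv_pos (convex_Icc 0 η)
    · exact fun t _ => (h3 t).continuousAt.continuousWithinAt
    · intro t ht
      rw [interior_Icc] at ht
      rw [(h3 t).deriv]
      have := h t ht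
      rw [iteratedFDeriv_two_apply] at this
      simp at this
      linarith
  have m2 : StrictMonoOn
      (fun t : ℝ => f (x + t • u) - f x - t * fderiv ℝ f x u + ε * t ^ 2) (Set.Icc 0 η) := by
    apply strictMonoOn_of_deriv_pos (convex_Icc 0 η)
    · exact fun t _ => (h4 t).continuousAt.continuousWithinAt
    · intro t ht
      rw [interior_Icc] at ht
      rw [(h4 t).deriv]
      simpa using m1 (Set.left_mem_Icc.2 hη.le) ⟨ht.1.le, ht.2.le⟩ ht.1
  simpa using m2 (Set.left_mem_Icc.2 hη.le) (Set.right_mem_Icc.2 hη.le) hη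

/-- **Negative curvature from expected decrease.** If `f` is twice continuously differentiable
with `B`-Lipschitz Hessian, `0 < η ≤ ε/B`, and a random unit vector `X` with mean zero satisfies
`E[f(x + η X)] ≤ f(x) − ε η²`, then the Hessian of `f` at `x` has an eigenvalue `≤ −ε`; in
particular some unit vector `u` satisfies `⟨u, ∇²f(x) u⟩ ≤ −ε`. -/
theorem negative_curvature_from_expected_decrease
    {d : ℕ} (f : EuclideanSpace ℝ (Fin d) → ℝ) (B ε η : ℝ)
    (hf : ContDiff ℝ 2 f)
    (hHessLip : ∀ u v : EuclideanSpace ℝ (Fin d),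
      ‖iteratedFDeriv ℝ 2 f u - iteratedFDeriv ℝ 2 f v‖ ≤ B * ‖u - v‖)
    (hε : 0 < ε) (hη : 0 < η) (hηB : η ≤ ε / B)
    (x : EuclideanSpace ℝ (Fin d))
    {Ω : Type*} [MeasurableSpace Ω] (μ : Measure Ω) [IsProbabilityMeasure μ]
    (X : Ω → EuclideanSpace ℝ (Fin d)) (hX : Measurable X)
    (hmean : (∫ ω, X ω ∂μ) = 0)
    (hnorm : ∀ᵐ ω ∂μ, ‖X ω‖ = 1)
    (hdec : (∫ ω, f (x + η • X ω) ∂μ) ≤ f x - ε * η ^ 2) :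
    ∃ u : EuclideanSpace ℝ (Fin d), ‖u‖ = 1 ∧
      iteratedFDeriv ℝ 2 f x ![u, u] ≤ -ε := by
  by_contra! hcon
  have hB : 0 < B := by
    by_contra hB
    have := div_nonpos_of_nonneg_of_nonpos hε.le (not_lt.1 hB)
    linarith
  have hBη : η * B ≤ ε := (le_div_iff₀ hB).1 hηB
  have key : ∀ u : EuclideanSpace ℝ (Fin d), ‖u‖ = 1 →
      0 < f (x + η • u) - f x - η * fderiv ℝ f x u + ε * η ^ 2 := by
    intro u hu
    apply taylor_strict_aux f hf x u ε η hη
    intro t ht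
    have h1 := hHessLip (x + t • u) x
    have h2 := (iteratedFDeriv ℝ 2 f (x + t • u) - iteratedFDeriv ℝ 2 f x).le_opNorm ![u, u]
    simp only [add_sub_cancel_left, norm_smul, hu, Real.norm_eq_abs, abs_of_pos ht.1,
      Fin.prod_univ_two, Matrix.cons_val_zero, Matrix.cons_val_one, mul_one,
      sub_apply] at h1 h2
    have h3 := (abs_le.1 h2).1
    have h4 := hcon u hu
    have h5 : B * t ≤ η * B := by nlinarith [ht.2]
    linarith
  have hXi : Integrable X μ := by
    refine Integrable.of_bound hX.aestronglyMeasurable 1 ?_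
    filter_upwards [hnorm] with ω h using h.le
  have hcont : Continuous (fun u : EuclideanSpace ℝ (Fin d) => f (x + η • u)) :=
    hf.continuous.comp (by fun_prop)
  obtain ⟨C, hC⟩ := (isCompact_closedBall (0 : EuclideanSpace ℝ (Fin d)) 1).exists_bound_of_continuousOn
    hcont.continuousOn
  have hfi : Integrable (fun ω => f (x + η • X ω)) μ := by
    refine Integrable.of_bound (hcont.measurable.comp hX).aestronglyMeasurable C ?_
    filter_upwards [hnorm] with ω h
    exact hC (X ω) (by simp [h])
  have hLi : Integrable (fun ω => η * fderiv ℝ f x (X ω)) μ :=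
    ((fderiv ℝ f x).integrable_comp hXi).const_mul η
  have hL : ∫ ω, η * fderiv ℝ f x (X ω) ∂μ = 0 := by
    rw [integral_const_mul, (fderiv ℝ f x).integral_comp_comm hXi, hmean]
    simp
  have hi1 : Integrable (fun ω => f (x + η • X ω) - f x) μ := hfi.sub (integrable_const _)
  have hi2 : Integrable (fun ω => f (x + η • X ω) - f x - η * fderiv ℝ f x (X ω)) μ := hi1.sub hLi
  have hi3 : Integrable
      (fun ω => f (x + η • X ω) - f x - η * fderiv ℝ f x (X ω) + ε * η ^ 2) μ :=
    hi2.add (integrable_const _)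
  have hint : ∫ ω, (f (x + η • X ω) - f x - η * fderiv ℝ f x (X ω) + ε * η ^ 2) ∂μ ≤ 0 := by
    rw [integral_add hi2 (integrable_const _), integral_sub hi1 hLi,
      integral_sub hfi (integrable_const _), hL]
    simp
    linarith
  have hpos : ∀ᵐ ω ∂μ, 0 < f (x + η • X ω) - f x - η * fderiv ℝ f x (X ω) + ε * η ^ 2 := by
    filter_upwards [hnorm] with ω h using key _ h
  have hnn : 0 ≤ᵐ[μ] fun ω => f (x + η • X ω) - f x - η * fderiv ℝ f x (X ω) + ε * η ^ 2 := by
    filter_upwards [hpos] with ω h using h.le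
  have hz := (integral_eq_zero_iff_of_nonneg_ae hnn hi3).1
    (le_antisymm hint (integral_nonneg_of_ae hnn))
  obtain ⟨ω, h1, h2⟩ := (hpos.and hz).exists
  simp only [Pi.zero_apply] at h2
  exact h1.ne' h2
end
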